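/- arXiv:2003.02073 — 2 statements merged into one kernel-verified Lean document; each statement's English description precedes it below -/
import Mathlib

section
/- Let (σ_η², ν_η, γ_η) ≠ (0, 0, 0) and (σ_Ũ², ν_Ũ, γ_Ũ) be Lévy triplets with ν_Ũ concentrated on [−1,∞), and let μ be an invariant probability measure for the generator A. Then there exists a constant K ∈ ℝ such that for every continuous compactly supported g: ℝ → ℝ, K ∫_ℝ g(z) dz = ∫_ℝ g(z) (σ_η²/2 + z² σ_Ũ²/2) μ(dz) + ∫_ℝ g(z) [ (S_η∗μ)(z) + r_μ(z) ] dz − ∫_ℝ g(z) [ D_μ(z) + ∫₀^z (B_η∗μ)(x) dx + ∫₀^z κ_μ(t) dt ] dz. -/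
open MeasureTheory Set Filter

noncomputable section

namespace KEF

def IsLevyMeasure (ν : Measure ℝ) : Prop :=
  ν {0} = 0 ∧ ∫⁻ y, ENNReal.ofReal (min 1 (y ^ 2)) ∂ν < ⊤

/-- The generator `A` of the killed generalized OU process, expressed through the
Lévy triplets `(ση2, νη, γη)` of `η` and `(σU2, νU, γU)` of `Ũ`. -/
def levyGen (ση2 γη σU2 γU : ℝ) (νη νU : Measure ℝ) (f : ℝ → ℝ) (x : ℝ) : ℝ :=
  γη * deriv f x + ση2 / 2 * deriv (deriv f) x
    + (∫ y, (f (x + y) - f x - (if |y| ≤ 1 then y * deriv f x else 0)) ∂νη)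
    + γU * (x * deriv f x) + σU2 / 2 * (x ^ 2 * deriv (deriv f) x)
    + ∫ y in Ici (-1 : ℝ), (f (x + x * y) - f x - (if |y| ≤ 1 then x * y * deriv f x else 0)) ∂νU

/-- `μ` is invariant for the generator: `∫ Af dμ = 0` for all test functions `f`. -/
def Invariant (ση2 γη σU2 γU : ℝ) (νη νU : Measure ℝ) (μ : Measure ℝ) : Prop :=
  ∀ f : ℝ → ℝ, ContDiff ℝ (⊤ : ℕ∞) f → HasCompactSupport f →
    ∫ x, levyGen ση2 γη σU2 γU νη νU f x ∂μ = 0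

def Bmap (ν : Measure ℝ) (z : ℝ) : ℝ :=
  if 0 < z then (ν (Ioi (max z 1))).toReal
  else if z < 0 then -((ν (Iio (min z (-1)))).toReal)
  else 0

def BUmap (ν : Measure ℝ) (z : ℝ) : ℝ :=
  if 1 < z then (ν (Ioi (max (z - 1) 1))).toReal else 0

def Smap (ν : Measure ℝ) (z : ℝ) : ℝ :=
  if 0 < z then ∫ y in Ici z ∩ Icc (-1 : ℝ) 1, (y - z) ∂ν
  else if z < 0 then ∫ y in Iic z ∩ Icc (-1 : ℝ) 1, (z - y) ∂ν
  else 0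

def SUmap (ν : Measure ℝ) (z : ℝ) : ℝ :=
  if 0 ≤ z ∧ z < 1 then ∫ y in Icc (-1 : ℝ) (z - 1), (z - 1 - y) ∂ν
  else if 1 < z then ∫ y in Ici (z - 1) ∩ Icc (-1 : ℝ) 1, (y - z + 1) ∂ν
  else 0

/-- convolution of a function with a measure -/
def convM (g : ℝ → ℝ) (μ : Measure ℝ) (z : ℝ) : ℝ := ∫ x, g (z - x) ∂μ

def rmu (νU : Measure ℝ) (μ : Measure ℝ) (z : ℝ) : ℝ :=
  if 0 < z then ∫ x in Ioi (0 : ℝ), x * SUmap νU (z / x) ∂μ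
  else if z < 0 then ∫ x in Iio (0 : ℝ), |x| * SUmap νU (z / x) ∂μ
  else 0

def kmu (νU : Measure ℝ) (μ : Measure ℝ) (t : ℝ) : ℝ :=
  if 0 < t then ∫ x in Ioc (0 : ℝ) t, BUmap νU (t / x) ∂μ
  else if t < 0 then -∫ x in Ico t (0 : ℝ), BUmap νU (t / x) ∂μ
  else 0

def Dmu (γη γU : ℝ) (μ : Measure ℝ) (z : ℝ) : ℝ :=
  if 0 ≤ z then ∫ x in Ioc (0 : ℝ) z, (γη + x * γU) ∂μ
  else -∫ x in Ioc z (0 : ℝ), (γη + x * γU) ∂μ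

end KEF

open KEF

namespace KEF

/-! ### Lévy measures -/

theorem IsLevyMeasure.integrable_min {ν : Measure ℝ} (hν : IsLevyMeasure ν) :
    Integrable (fun y : ℝ => min 1 (y ^ 2)) ν := by
  refine ⟨by fun_prop, ?_⟩
  rw [hasFiniteIntegral_iff_ofReal]
  · exact hν.2
  · exact Eventually.of_forall fun y => le_min zero_le_one (sq_nonneg y)

theorem IsLevyMeasure.sigmaFinite {ν : Measure ℝ} (hν : IsLevyMeasure ν) : SigmaFinite ν := by
  set d : ℝ → ENNReal := fun y => ENNReal.ofReal (min 1 (y ^ 2)) with hd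
  have hdm : Measurable d := by fun_prop
  have hfin : IsFiniteMeasure (ν.withDensity d) := isFiniteMeasure_withDensity hν.2.ne
  have hne : ∀ᵐ y ∂ν, d y ≠ 0 := by
    have h0 : ∀ᵐ y ∂ν, y ≠ 0 := by
      rw [ae_iff]; simpa using hν.1
    filter_upwards [h0] with y hy
    have : 0 < min 1 (y ^ 2) := lt_min one_pos (by positivity)
    exact (ENNReal.ofReal_pos.2 this).ne'
  have hinv : (ν.withDensity d).withDensity d⁻¹ = ν :=
    withDensity_inv_same hdm hne (Eventually.of_forall fun y => by simp [hd])
  rw [← hinv]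
  refine SigmaFinite.withDensity_of_ne_top ?_
  rw [ae_withDensity_iff hdm]
  filter_upwards [hne] with y hy _
  simpa using hy

theorem IsLevyMeasure.measure_lt_top {ν : Measure ℝ} (hν : IsLevyMeasure ν)
    {s : Set ℝ} {r : ℝ} (hr : 0 < r) (h : ∀ y ∈ s, r ≤ |y|) :
    ν s < ⊤ := by
  have hc : 0 < min 1 (r ^ 2) := lt_min one_pos (by positivity)
  have := hν.integrable_min.measure_norm_ge_lt_top hc
  refine (measure_mono fun y hy => ?_).trans_lt this
  have h2 : r ^ 2 ≤ y ^ 2 := by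
    rw [← sq_abs y]; exact pow_le_pow_left₀ hr.le (h y hy) 2
  have h3 : min 1 (r ^ 2) ≤ min 1 (y ^ 2) := min_le_min le_rfl h2
  exact h3.trans (le_abs_self _)

/-! ### Taylor kernels -/

/-- Taylor kernel of the compensated jumps of size at most one. -/
def kerS (w y : ℝ) : ℝ :=
  if 0 < w ∧ w ≤ y ∧ y ≤ 1 then y - w else if w < 0 ∧ y ≤ w ∧ -1 ≤ y then w - y else 0

/-- Kernel of the jumps of size larger than one. -/
def kerB (w y : ℝ) : ℝ :=
  if 0 < w ∧ w < y ∧ 1 < y then 1 else if w < 0 ∧ y < w ∧ y < -1 then -1 else 0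

theorem measurable_kerS : Measurable (Function.uncurry kerS) := by
  unfold Function.uncurry kerS
  refine Measurable.ite ?_ (by fun_prop) (Measurable.ite ?_ (by fun_prop) (by fun_prop))
  · exact (measurableSet_lt measurable_const measurable_fst).inter
      ((measurableSet_le measurable_fst measurable_snd).inter
        (measurableSet_le measurable_snd measurable_const))
  · exact (measurableSet_lt measurable_fst measurable_const).inter
      ((measurableSet_le measurable_snd measurable_fst).inter
        (measurableSet_le measurable_const measurable_snd))

theorem measurable_kerB : Measurable (Function.uncurry kerB) := by
  unfold Function.uncurry kerB
  refine Measurable.ite ?_ (by fun_prop) (Measurable.ite ?_ (by fun_prop) (by fun_prop))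
  · exact (measurableSet_lt measurable_const measurable_fst).inter
      ((measurableSet_lt measurable_fst measurable_snd).inter
        (measurableSet_lt measurable_const measurable_snd))
  · exact (measurableSet_lt measurable_fst measurable_const).inter
      ((measurableSet_lt measurable_snd measurable_fst).inter
        (measurableSet_lt measurable_snd measurable_const))

theorem kerS_nonneg (w y : ℝ) : 0 ≤ kerS w y := by
  unfold kerS; split_ifs <;> linarith

theorem kerS_le_indicator (w y : ℝ) : kerS w y ≤ (Icc (-1 : ℝ) 1).indicator (fun _ => 1) w := by
  unfold kerS indicator
  simp only [mem_Icc]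
  split_ifs <;> grind

theorem abs_kerB_le (w y : ℝ) : |kerB w y| ≤ {y : ℝ | 1 < |y|}.indicator (fun _ => 1) y := by
  unfold kerB indicator
  simp only [mem_ofPred_eq, lt_abs]
  split_ifs <;> grind

theorem Smap_eq_integral_kerS (ν : Measure ℝ) (w : ℝ) : Smap ν w = ∫ y, kerS w y ∂ν := by
  unfold Smap kerS
  split_ifs with h1 h2
  · rw [← integral_indicator (by measurability)]
    congr 1 with y
    simp only [indicator, mem_inter_iff, mem_Ici, mem_Icc]
    split_ifs <;> grind
  · rw [← integral_indicator (by measurability)]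
    congr 1 with y
    simp only [indicator, mem_inter_iff, mem_Iic, mem_Icc]
    split_ifs <;> grind
  · simp [h1, h2]

theorem Bmap_eq_integral_kerB (ν : Measure ℝ) (w : ℝ) : Bmap ν w = ∫ y, kerB w y ∂ν := by
  unfold Bmap kerB
  split_ifs with h1 h2
  · rw [← measureReal_def, ← mul_one (ν.real _), ← smul_eq_mul, ← setIntegral_const, ← integral_indicator (by measurability)]
    congr 1 with y
    simp only [indicator, mem_Ioi, max_lt_iff]
    split_ifs <;> grind
  · rw [← measureReal_def, ← mul_one (ν.real _), ← smul_eq_mul, ← setIntegral_const, ← integral_neg,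
      ← integral_indicator (by measurability)]
    congr 1 with y
    simp only [indicator, mem_Iio, lt_min_iff]
    split_ifs <;> grind
  · simp [h1, h2]

theorem integral_mul_kerS {F H G : ℝ → ℝ} (hF : ∀ x, HasDerivAt F (H x) x)
    (hH : ∀ x, HasDerivAt H (G x) x) (hG : Continuous G) (y : ℝ) :
    ∫ w, G w * kerS w y = if |y| ≤ 1 then F y - F 0 - y * H 0 else 0 := by
  split_ifs with hy
  · rw [abs_le] at hy
    rcases le_total 0 y with h0 | h0
    · have e : (fun w => G w * kerS w y) = (Ioc 0 y).indicator (fun w => G w * (y - w)) := by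
        ext w
        simp only [indicator, mem_Ioc, kerS]
        split_ifs <;> grind
      rw [e, integral_indicator measurableSet_Ioc, ← intervalIntegral.integral_of_le h0,
        intervalIntegral.integral_eq_sub_of_hasDerivAt (f := fun w => H w * (y - w) + F w)]
      · ring
      · intro w _
        have := ((hH w).mul ((hasDerivAt_id' w).const_sub y)).add (hF w)
        exact this.congr_deriv (by ring)
      · exact (by fun_prop : Continuous fun w => G w * (y - w)).intervalIntegrable _ _
    · have e : (fun w => G w * kerS w y) = (Ico y 0).indicator (fun w => G w * (w - y)) := by
        ext w
        simp only [indicator, mem_Ico, kerS]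
        split_ifs <;> grind
      rw [e, integral_indicator measurableSet_Ico, integral_Ico_eq_integral_Ioo,
        ← integral_Ioc_eq_integral_Ioo, ← intervalIntegral.integral_of_le h0,
        intervalIntegral.integral_eq_sub_of_hasDerivAt (f := fun w => H w * (w - y) - F w)]
      · ring
      · intro w _
        have := ((hH w).mul ((hasDerivAt_id' w).sub_const y)).sub (hF w)
        exact this.congr_deriv (by ring)
      · exact (by fun_prop : Continuous fun w => G w * (w - y)).intervalIntegrable _ _
  · have : ∀ w, kerS w y = 0 := by
      intro w
      rw [abs_le] at hy
      unfold kerS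
      split_ifs <;> grind
    simp [this]

theorem integral_mul_kerB {F H : ℝ → ℝ} (hF : ∀ x, HasDerivAt F (H x) x)
    (hH : Continuous H) (y : ℝ) :
    ∫ w, H w * kerB w y = if |y| ≤ 1 then 0 else F y - F 0 := by
  split_ifs with hy
  · have : ∀ w, kerB w y = 0 := by
      intro w
      rw [abs_le] at hy
      unfold kerB
      split_ifs <;> grind
    simp [this]
  · rw [abs_le] at hy
    rcases le_total 0 y with h0 | h0
    · have e : (fun w => H w * kerB w y) = (Ioo 0 y).indicator H := by
        ext w
        simp only [indicator, mem_Ioo, kerB]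
        split_ifs <;> grind
      rw [e, integral_indicator measurableSet_Ioo, ← integral_Ioc_eq_integral_Ioo,
        ← intervalIntegral.integral_of_le h0,
        intervalIntegral.integral_eq_sub_of_hasDerivAt (fun w _ => hF w)
          (hH.intervalIntegrable _ _)]
    · have e : (fun w => H w * kerB w y) = (Ioo y 0).indicator (fun w => -H w) := by
        ext w
        simp only [indicator, mem_Ioo, kerB]
        split_ifs <;> grind
      rw [e, integral_indicator measurableSet_Ioo, ← integral_Ioc_eq_integral_Ioo,
        integral_neg, ← intervalIntegral.integral_of_le h0,
        intervalIntegral.integral_eq_sub_of_hasDerivAt (fun w _ => hF w)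
          (hH.intervalIntegrable _ _)]
      ring

theorem integral_kerS (y : ℝ) : ∫ w, kerS w y = if |y| ≤ 1 then y ^ 2 / 2 else 0 := by
  have h := integral_mul_kerS (F := fun w => w ^ 2 / 2) (H := fun w => w) (G := fun _ => 1)
    (fun x => ((hasDerivAt_pow 2 x).div_const 2).congr_deriv (by norm_num))
    (fun x => hasDerivAt_id' x) continuous_const y
  simpa using h

theorem integrable_kerS_left (y : ℝ) : Integrable (fun w => kerS w y) := by
  refine Integrable.mono' (g := (Icc (-1 : ℝ) 1).indicator (fun _ => 1)) ?_ ?_ ?_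
  · exact (integrable_indicator_iff measurableSet_Icc).2 (by simp)
  · exact (measurable_kerS.comp (measurable_id.prodMk measurable_const)).aestronglyMeasurable
  · refine Eventually.of_forall fun w => ?_
    simpa [abs_of_nonneg (kerS_nonneg w y)] using kerS_le_indicator w y

theorem integrable_kerS {ν : Measure ℝ} (hν : IsLevyMeasure ν) :
    Integrable (Function.uncurry kerS) (volume.prod ν) := by
  have := hν.sigmaFinite
  rw [integrable_prod_iff' measurable_kerS.aestronglyMeasurable]
  refine ⟨Eventually.of_forall integrable_kerS_left, hν.integrable_min.mono' ?_ ?_⟩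
  · exact (measurable_kerS.norm.stronglyMeasurable.integral_prod_left).aestronglyMeasurable
  · refine Eventually.of_forall fun y => ?_
    simp only [Function.uncurry_apply_pair, Real.norm_eq_abs, abs_of_nonneg (kerS_nonneg _ _),
      integral_kerS]
    split_ifs with hy
    · have : y ^ 2 ≤ 1 := by rw [← sq_abs]; exact pow_le_one₀ (abs_nonneg y) hy
      rw [min_eq_right this, abs_le]
      constructor <;> nlinarith [sq_nonneg y]
    · simp only [abs_zero]
      exact le_min zero_le_one (sq_nonneg y)

theorem integrable_indicator_one_lt_abs {ν : Measure ℝ} (hν : IsLevyMeasure ν) :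
    Integrable ({y : ℝ | 1 < |y|}.indicator (fun _ => (1 : ℝ))) ν := by
  have hm : MeasurableSet {y : ℝ | 1 < |y|} := measurableSet_lt measurable_const (by fun_prop)
  refine (integrable_indicator_iff hm).2 (integrableOn_const ?_)
  exact (hν.measure_lt_top one_pos fun y hy => le_of_lt hy).ne

theorem measurable_Smap {ν : Measure ℝ} (hν : IsLevyMeasure ν) : Measurable (Smap ν) := by
  have := hν.sigmaFinite
  rw [funext (Smap_eq_integral_kerS ν)]
  exact measurable_kerS.stronglyMeasurable.integral_prod_right.measurable

theorem measurable_Bmap {ν : Measure ℝ} (hν : IsLevyMeasure ν) : Measurable (Bmap ν) := by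
  have := hν.sigmaFinite
  rw [funext (Bmap_eq_integral_kerB ν)]
  exact measurable_kerB.stronglyMeasurable.integral_prod_right.measurable

theorem Smap_nonneg (ν : Measure ℝ) (w : ℝ) : 0 ≤ Smap ν w := by
  rw [Smap_eq_integral_kerS]
  exact integral_nonneg fun y => kerS_nonneg w y

theorem integrable_Smap {ν : Measure ℝ} (hν : IsLevyMeasure ν) : Integrable (Smap ν) := by
  have := hν.sigmaFinite
  rw [funext (Smap_eq_integral_kerS ν)]
  exact (integrable_kerS hν).integral_prod_left

theorem exists_abs_Bmap_le {ν : Measure ℝ} (hν : IsLevyMeasure ν) :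
    ∃ C, ∀ w, |Bmap ν w| ≤ C := by
  refine ⟨∫ y, {y : ℝ | 1 < |y|}.indicator (fun _ => (1 : ℝ)) y ∂ν, fun w => ?_⟩
  rw [Bmap_eq_integral_kerB, ← Real.norm_eq_abs]
  exact norm_integral_le_of_norm_le (integrable_indicator_one_lt_abs hν)
    (Eventually.of_forall fun y => abs_kerB_le w y)

/-- The jump part of a Lévy generator at `0` in terms of the kernels `Smap` and `Bmap`. -/
theorem integral_jump_eq {ν : Measure ℝ} (hν : IsLevyMeasure ν) {F H G : ℝ → ℝ}
    (hF : ∀ x, HasDerivAt F (H x) x) (hH : ∀ x, HasDerivAt H (G x) x) (hG : Continuous G)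
    (hGb : ∃ C, ∀ x, |G x| ≤ C) (hHi : Integrable H) :
    ∫ y, (F y - F 0 - (if |y| ≤ 1 then y * H 0 else 0)) ∂ν
      = (∫ w, G w * Smap ν w) + ∫ w, H w * Bmap ν w := by
  have := hν.sigmaFinite
  obtain ⟨C, hC⟩ := hGb
  have hHc : Continuous H := continuous_iff_continuousAt.2 fun x => (hH x).continuousAt
  have iS : Integrable (Function.uncurry fun w y => G w * kerS w y) (volume.prod ν) := by
    refine (integrable_kerS hν).bdd_mul (c := C) (f := fun p : ℝ × ℝ => G p.1)
      (by fun_prop) (Eventually.of_forall fun p => hC p.1)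
  have iB : Integrable (Function.uncurry fun w y => H w * kerB w y) (volume.prod ν) := by
    refine (hHi.norm.mul_prod (integrable_indicator_one_lt_abs hν)).mono' ?_ ?_
    · exact ((hHc.measurable.comp measurable_fst).mul measurable_kerB).aestronglyMeasurable
    · refine Eventually.of_forall fun p => ?_
      simp only [Function.uncurry, norm_mul]
      exact mul_le_mul_of_nonneg_left (abs_kerB_le _ _) (norm_nonneg _)
  simp_rw [Smap_eq_integral_kerS, Bmap_eq_integral_kerB, ← integral_const_mul]
  rw [integral_integral_swap iS, integral_integral_swap iB]
  refine Eq.trans ?_ (integral_add iS.integral_prod_right iB.integral_prod_right)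
  refine integral_congr_ae (Eventually.of_forall fun y => ?_)
  simp only [integral_mul_kerS hF hH hG, integral_mul_kerB hF hHc]
  split_ifs <;> ring

/-! ### Uniform bounds and passage to the limit in the generator -/

theorem abs_taylor_le {F H G : ℝ → ℝ} (hF : ∀ x, HasDerivAt F (H x) x)
    (hH : ∀ x, HasDerivAt H (G x) x) (hG : Continuous G) {y C : ℝ} (hy : |y| ≤ 1)
    (hC : ∀ w, |w| ≤ |y| → |G w| ≤ C) :
    |F y - F 0 - y * H 0| ≤ C * (y ^ 2 / 2) := by
  have h1 := integral_mul_kerS hF hH hG y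
  have h2 := integral_kerS y
  rw [if_pos hy] at h1 h2
  rw [← h1, ← h2, ← integral_const_mul, ← Real.norm_eq_abs]
  refine norm_integral_le_of_norm_le ((integrable_kerS_left y).const_mul C)
    (Eventually.of_forall fun w => ?_)
  rw [norm_mul, Real.norm_eq_abs, Real.norm_eq_abs, abs_of_nonneg (kerS_nonneg w y)]
  by_cases hw : |w| ≤ |y|
  · exact mul_le_mul_of_nonneg_right (hC w hw) (kerS_nonneg w y)
  · have : kerS w y = 0 := by
      unfold kerS
      split_ifs <;> grind
    simp [this]

/-- `h` and `g` are the first two derivatives of `f`, and `f`, `h`, `g`, `x h(x)`, `x² g(x)` are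
all bounded by `M`. -/
structure TestTriple (f h g : ℝ → ℝ) (M : ℝ) : Prop where
  deriv1 : ∀ x, HasDerivAt f (h x) x
  deriv2 : ∀ x, HasDerivAt h (g x) x
  cont : Continuous g
  bound0 : ∀ x, |f x| ≤ M
  bound1 : ∀ x, |h x| ≤ M
  bound2 : ∀ x, |g x| ≤ M
  wbound1 : ∀ x, |x * h x| ≤ M
  wbound2 : ∀ x, |x ^ 2 * g x| ≤ M

namespace TestTriple

variable {f h g : ℝ → ℝ} {M : ℝ}

theorem cont0 (T : TestTriple f h g M) : Continuous f :=
  continuous_iff_continuousAt.2 fun x => (T.deriv1 x).continuousAt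

theorem cont1 (T : TestTriple f h g M) : Continuous h :=
  continuous_iff_continuousAt.2 fun x => (T.deriv2 x).continuousAt

theorem nonneg (T : TestTriple f h g M) : 0 ≤ M := (abs_nonneg _).trans (T.bound0 0)

theorem abs_jump_add_le (T : TestTriple f h g M) (x y : ℝ) :
    |f (x + y) - f x - (if |y| ≤ 1 then y * h x else 0)| ≤ 2 * M * min 1 (y ^ 2) := by
  have hM := T.nonneg
  split_ifs with hy
  · have := abs_taylor_le (F := fun w => f (x + w)) (H := fun w => h (x + w))
      (G := fun w => g (x + w)) (fun w => (T.deriv1 (x + w)).comp_const_add x w)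
      (fun w => (T.deriv2 (x + w)).comp_const_add x w)
      (T.cont.comp (by fun_prop)) hy (fun w _ => T.bound2 _)
    simp only [add_zero] at this
    have h1 : y ^ 2 ≤ 1 := by rw [← sq_abs]; exact pow_le_one₀ (abs_nonneg y) hy
    rw [min_eq_right h1]
    nlinarith [sq_nonneg y]
  · have h1 : 1 ≤ y ^ 2 := by rw [← sq_abs]; exact one_le_pow₀ (not_le.1 hy).le
    rw [min_eq_left h1]
    have a := abs_le.1 (T.bound0 (x + y))
    have b := abs_le.1 (T.bound0 x)
    rw [abs_le]; constructor <;> linarith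

theorem abs_jump_mul_le (T : TestTriple f h g M) (x y : ℝ) :
    |f (x + x * y) - f x - (if |y| ≤ 1 then x * y * h x else 0)| ≤ 12 * M * min 1 (y ^ 2) := by
  have hM := T.nonneg
  by_cases hy2 : |y| ≤ 1 / 2
  · have hy : |y| ≤ 1 := by linarith
    have hd : ∀ w, HasDerivAt (fun w => x + x * w) x w := fun w => by
      simpa using ((hasDerivAt_id' w).const_mul x).const_add x
    have := abs_taylor_le (F := fun w => f (x + x * w)) (H := fun w => h (x + x * w) * x)
      (G := fun w => g (x + x * w) * x * x) (fun w => (T.deriv1 (x + x * w)).comp w (hd w))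
      (fun w => ((T.deriv2 (x + x * w)).comp w (hd w)).mul_const x)
      (((T.cont.comp (by fun_prop)).mul continuous_const).mul continuous_const)
      hy (C := 4 * M) (fun w hw => by
        have h1 := T.wbound2 (x + x * w)
        have h2 : |w| ≤ 1 / 2 := hw.trans hy2
        rw [abs_le] at h2
        have h3 : x ^ 2 ≤ 4 * (x + x * w) ^ 2 := by
          have : (1 : ℝ) ≤ 4 * (1 + w) ^ 2 := by nlinarith
          nlinarith [sq_nonneg x]
        rw [abs_mul, abs_of_nonneg (sq_nonneg (x + x * w))] at h1
        rw [mul_assoc, abs_mul, abs_of_nonneg (mul_self_nonneg x)]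
        nlinarith [abs_nonneg (g (x + x * w))])
    simp only [mul_zero, add_zero] at this
    rw [if_pos hy]
    have h1 : y ^ 2 ≤ 1 := by rw [← sq_abs]; exact pow_le_one₀ (abs_nonneg y) hy
    rw [min_eq_right h1, show x * y * h x = y * (h x * x) by ring]
    nlinarith [sq_nonneg y]
  · have h1 : 1 / 4 ≤ min 1 (y ^ 2) := by
      refine le_min (by norm_num) ?_
      rw [← sq_abs]; nlinarith
    have a := abs_le.1 (T.bound0 (x + x * y))
    have b := abs_le.1 (T.bound0 x)
    have c := T.wbound1 x
    have key : |f (x + x * y) - f x - (if |y| ≤ 1 then x * y * h x else 0)| ≤ 3 * M := by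
      split_ifs with hy
      · have d : |x * y * h x| ≤ M := by
          rw [show x * y * h x = y * (x * h x) by ring, abs_mul]
          nlinarith [abs_nonneg y, abs_nonneg (x * h x)]
        rw [abs_le] at d ⊢
        constructor <;> linarith
      · rw [abs_le]; constructor <;> linarith
    nlinarith

theorem levyGen_eq (T : TestTriple f h g M) (ση2 γη σU2 γU : ℝ) (νη νU : Measure ℝ) (x : ℝ) :
    levyGen ση2 γη σU2 γU νη νU f x = γη * h x + ση2 / 2 * g x
    + (∫ y, (f (x + y) - f x - (if |y| ≤ 1 then y * h x else 0)) ∂νη)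
    + γU * (x * h x) + σU2 / 2 * (x ^ 2 * g x)
    + ∫ y in Ici (-1 : ℝ), (f (x + x * y) - f x - (if |y| ≤ 1 then x * y * h x else 0)) ∂νU := by
  have e1 : deriv f = h := funext fun x => (T.deriv1 x).deriv
  have e2 : deriv h = g := funext fun x => (T.deriv2 x).deriv
  simp only [levyGen, e1, e2]

theorem measurable_jump_add (T : TestTriple f h g M) : Measurable
    (fun p : ℝ × ℝ => f (p.1 + p.2) - f p.1 - (if |p.2| ≤ 1 then p.2 * h p.1 else 0)) := by
  have h0 := T.cont0.measurable
  have h1 := T.cont1.measurable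
  refine Measurable.sub (by fun_prop) (Measurable.ite ?_ (by fun_prop) (by fun_prop))
  exact measurableSet_le (by fun_prop) measurable_const

theorem measurable_jump_mul (T : TestTriple f h g M) : Measurable
    (fun p : ℝ × ℝ =>
      f (p.1 + p.1 * p.2) - f p.1 - (if |p.2| ≤ 1 then p.1 * p.2 * h p.1 else 0)) := by
  have h0 := T.cont0.measurable
  have h1 := T.cont1.measurable
  refine Measurable.sub (by fun_prop) (Measurable.ite ?_ (by fun_prop) (by fun_prop))
  exact measurableSet_le (by fun_prop) measurable_const

theorem measurable_levyGen (T : TestTriple f h g M) (ση2 γη σU2 γU : ℝ) {νη νU : Measure ℝ}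
    [SFinite νη] [SFinite νU] : Measurable (levyGen ση2 γη σU2 γU νη νU f) := by
  have h1 := T.cont1.measurable
  have h2 := T.cont.measurable
  rw [funext (T.levyGen_eq ση2 γη σU2 γU νη νU)]
  have a := (T.measurable_jump_add.stronglyMeasurable.integral_prod_right' (ν := νη)).measurable
  have b := (T.measurable_jump_mul.stronglyMeasurable.integral_prod_right'
    (ν := νU.restrict (Ici (-1)))).measurable
  fun_prop

theorem abs_levyGen_le (T : TestTriple f h g M) (ση2 γη σU2 γU : ℝ) {νη νU : Measure ℝ}
    (hνη : IsLevyMeasure νη) (hνU : IsLevyMeasure νU) (x : ℝ) :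
    |levyGen ση2 γη σU2 γU νη νU f x| ≤ |γη| * M + |ση2 / 2| * M
      + (∫ y, 2 * M * min 1 (y ^ 2) ∂νη) + |γU| * M + |σU2 / 2| * M
      + ∫ y in Ici (-1 : ℝ), 12 * M * min 1 (y ^ 2) ∂νU := by
  rw [T.levyGen_eq]
  have a := norm_integral_le_of_norm_le (hνη.integrable_min.const_mul (2 * M))
    (Eventually.of_forall fun y => (Real.norm_eq_abs _).trans_le (T.abs_jump_add_le x y))
  have b := norm_integral_le_of_norm_le (hνU.integrable_min.restrict.const_mul (12 * M))
    (Eventually.of_forall fun y => (Real.norm_eq_abs _).trans_le (T.abs_jump_mul_le x y))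
    (μ := νU.restrict (Ici (-1)))
  have m : ∀ c u : ℝ, |u| ≤ M → |c * u| ≤ |c| * M := fun c u hu => by
    rw [abs_mul]; exact mul_le_mul_of_nonneg_left hu (abs_nonneg c)
  refine (abs_add_le _ _).trans (add_le_add ((abs_add_le _ _).trans (add_le_add
    ((abs_add_le _ _).trans (add_le_add ((abs_add_le _ _).trans (add_le_add
    ((abs_add_le _ _).trans (add_le_add ?_ ?_)) a)) ?_)) ?_)) b)
  · exact m _ _ (T.bound1 x)
  · exact m _ _ (T.bound2 x)
  · exact m _ _ (T.wbound1 x)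
  · exact m _ _ (T.wbound2 x)

end TestTriple

theorem tendsto_integral_levyGen (ση2 γη σU2 γU : ℝ) {νη νU : Measure ℝ}
    (hνη : IsLevyMeasure νη) (hνU : IsLevyMeasure νU) (μ : Measure ℝ) [IsFiniteMeasure μ]
    {fn hn gn : ℕ → ℝ → ℝ} {f h g : ℝ → ℝ} {M M' : ℝ}
    (Tn : ∀ n, TestTriple (fn n) (hn n) (gn n) M) (T : TestTriple f h g M')
    (hf : ∀ x, Tendsto (fun n => fn n x) atTop (nhds (f x)))
    (hh : ∀ x, Tendsto (fun n => hn n x) atTop (nhds (h x)))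
    (hg : ∀ x, Tendsto (fun n => gn n x) atTop (nhds (g x))) :
    Tendsto (fun n => ∫ x, levyGen ση2 γη σU2 γU νη νU (fn n) x ∂μ) atTop
      (nhds (∫ x, levyGen ση2 γη σU2 γU νη νU f x ∂μ)) := by
  have := hνη.sigmaFinite
  have := hνU.sigmaFinite
  refine tendsto_integral_of_dominated_convergence (fun _ => |γη| * M + |ση2 / 2| * M
      + (∫ y, 2 * M * min 1 (y ^ 2) ∂νη) + |γU| * M + |σU2 / 2| * M
      + ∫ y in Ici (-1 : ℝ), 12 * M * min 1 (y ^ 2) ∂νU)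
    (fun n => ((Tn n).measurable_levyGen ση2 γη σU2 γU).aestronglyMeasurable)
    (integrable_const _)
    (fun n => Eventually.of_forall ((Tn n).abs_levyGen_le ση2 γη σU2 γU hνη hνU))
    (Eventually.of_forall fun x => ?_)
  simp only [(Tn _).levyGen_eq, T.levyGen_eq]
  have a : Tendsto (fun n => ∫ y, (fn n (x + y) - fn n x - (if |y| ≤ 1 then y * hn n x else 0)) ∂νη)
      atTop (nhds (∫ y, (f (x + y) - f x - (if |y| ≤ 1 then y * h x else 0)) ∂νη)) := by
    refine tendsto_integral_of_dominated_convergence (fun y => 2 * M * min 1 (y ^ 2))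
      (fun n => ((Tn n).measurable_jump_add.comp measurable_prodMk_left).aestronglyMeasurable)
      (hνη.integrable_min.const_mul _)
      (fun n => Eventually.of_forall ((Tn n).abs_jump_add_le x))
      (Eventually.of_forall fun y => ?_)
    refine ((hf _).sub (hf _)).sub ?_
    split_ifs
    · exact (hh x).const_mul y
    · exact tendsto_const_nhds
  have b : Tendsto (fun n => ∫ y in Ici (-1 : ℝ),
        (fn n (x + x * y) - fn n x - (if |y| ≤ 1 then x * y * hn n x else 0)) ∂νU) atTop
      (nhds (∫ y in Ici (-1 : ℝ),
        (f (x + x * y) - f x - (if |y| ≤ 1 then x * y * h x else 0)) ∂νU)) := by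
    refine tendsto_integral_of_dominated_convergence (fun y => 12 * M * min 1 (y ^ 2))
      (fun n => ((Tn n).measurable_jump_mul.comp measurable_prodMk_left).aestronglyMeasurable)
      (hνU.integrable_min.restrict.const_mul _)
      (fun n => Eventually.of_forall ((Tn n).abs_jump_mul_le x))
      (Eventually.of_forall fun y => ?_)
    refine ((hf _).sub (hf _)).sub ?_
    split_ifs
    · exact (hh x).const_mul (x * y)
    · exact tendsto_const_nhds
  exact ((((((hh x).const_mul _).add ((hg x).const_mul _)).add a).add
    (((hh x).const_mul x).const_mul γU)).add (((hg x).const_mul _).const_mul _)).add b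

/-- A triple with bounded `f` whose derivatives have compact support. -/
theorem exists_testTriple {f h g : ℝ → ℝ} (hf : ∀ x, HasDerivAt f (h x) x)
    (hh : ∀ x, HasDerivAt h (g x) x) (hg : Continuous g) (hfb : ∃ C, ∀ x, |f x| ≤ C)
    (hhs : HasCompactSupport h) (hgs : HasCompactSupport g) : ∃ M, TestTriple f h g M := by
  have hhc : Continuous h := continuous_iff_continuousAt.2 fun x => (hh x).continuousAt
  obtain ⟨c0, h0⟩ := hfb
  obtain ⟨c1, h1⟩ := hhs.exists_bound_of_continuous hhc
  obtain ⟨c2, h2⟩ := hgs.exists_bound_of_continuous hg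
  obtain ⟨c3, h3⟩ := (hhs.mul_left (f := fun x => x)).exists_bound_of_continuous
    (continuous_id.mul hhc)
  obtain ⟨c4, h4⟩ := (hgs.mul_left (f := fun x => x ^ 2)).exists_bound_of_continuous
    ((continuous_pow 2).mul hg)
  exact ⟨max c0 (max c1 (max c2 (max c3 c4))), hf, hh, hg,
    fun x => (h0 x).trans (by simp), fun x => (h1 x).trans (by simp),
    fun x => (h2 x).trans (by simp), fun x => (h3 x).trans (by simp),
    fun x => (h4 x).trans (by simp)⟩

/-- Multiplication by a rescaled cutoff function keeps the bounds of a triple. -/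
theorem TestTriple.mul_rescale {f h g c c' c'' : ℝ → ℝ} {M N a : ℝ} (T : TestTriple f h g M)
    (S : TestTriple c c' c'' N) (ha : 0 ≤ a) (ha1 : a ≤ 1) :
    TestTriple (fun x => f x * c (x * a)) (fun x => h x * c (x * a) + f x * (c' (x * a) * a))
      (fun x => g x * c (x * a) + 2 * (h x * (c' (x * a) * a)) + f x * (c'' (x * a) * a * a))
      (4 * (M * N)) := by
  have hM := T.nonneg
  have hN := S.nonneg
  have hMN : 0 ≤ M * N := mul_nonneg hM hN
  have p : ∀ u v : ℝ, |u| ≤ M → |v| ≤ N → |u * v| ≤ M * N := fun u v hu hv => by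
    rw [abs_mul]; exact mul_le_mul hu hv (abs_nonneg _) hM
  have q : ∀ v : ℝ, |v| ≤ N → |v * a| ≤ N := fun v hv => by
    rw [abs_mul, abs_of_nonneg ha]
    nlinarith [abs_nonneg v]
  have hd : ∀ x, HasDerivAt (fun x => x * a) a x := fun x => by
    simpa using (hasDerivAt_id' x).mul_const a
  have cc := S.cont
  have cc0 := S.cont0
  have cc1 := S.cont1
  have c1 := T.cont1
  have c0 := T.cont0
  have c2 := T.cont
  refine ⟨fun x => (T.deriv1 x).mul ((S.deriv1 (x * a)).comp x (hd x)), fun x => ?_, by fun_prop,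
    fun x => ?_, fun x => ?_, fun x => ?_, fun x => ?_, fun x => ?_⟩
  · refine (((T.deriv2 x).mul ((S.deriv1 (x * a)).comp x (hd x))).add ((T.deriv1 x).mul
      (((S.deriv2 (x * a)).comp x (hd x)).mul_const a))).congr_deriv ?_
    simp only [Function.comp_apply]
    ring
  · have := p _ _ (T.bound0 x) (S.bound0 (x * a))
    linarith
  · have a1 := abs_le.1 (p _ _ (T.bound1 x) (S.bound0 (x * a)))
    have a2 := abs_le.1 (p _ _ (T.bound0 x) (q _ (S.bound1 (x * a))))
    rw [abs_le]; constructor <;> linarith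
  · have a1 := abs_le.1 (p _ _ (T.bound2 x) (S.bound0 (x * a)))
    have a2 := abs_le.1 (p _ _ (T.bound1 x) (q _ (S.bound1 (x * a))))
    have a3 := abs_le.1 (p _ _ (T.bound0 x) (q _ (q _ (S.bound2 (x * a)))))
    rw [abs_le]; constructor <;> linarith
  · have a1 := abs_le.1 (p _ _ (T.wbound1 x) (S.bound0 (x * a)))
    have a2 := abs_le.1 (p _ _ (T.bound0 x) (S.wbound1 (x * a)))
    rw [show x * (h x * c (x * a) + f x * (c' (x * a) * a))
      = x * h x * c (x * a) + f x * (x * a * c' (x * a)) by ring]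
    rw [abs_le]; constructor <;> linarith
  · have a1 := abs_le.1 (p _ _ (T.wbound2 x) (S.bound0 (x * a)))
    have a2 := abs_le.1 (p _ _ (T.wbound1 x) (S.wbound1 (x * a)))
    have a3 := abs_le.1 (p _ _ (T.bound0 x) (S.wbound2 (x * a)))
    rw [show x ^ 2 * (g x * c (x * a) + 2 * (h x * (c' (x * a) * a)) + f x * (c'' (x * a) * a * a))
      = x ^ 2 * g x * c (x * a) + 2 * (x * h x * (x * a * c' (x * a)))
        + f x * ((x * a) ^ 2 * c'' (x * a)) by ring]
    rw [abs_le]; constructor <;> linarith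

/-- Invariance extends to bounded smooth functions with compactly supported derivative. -/
theorem Invariant.integral_levyGen_eq_zero {ση2 γη σU2 γU : ℝ} {νη νU μ : Measure ℝ}
    [IsFiniteMeasure μ] (hinv : Invariant ση2 γη σU2 γU νη νU μ)
    (hνη : IsLevyMeasure νη) (hνU : IsLevyMeasure νU) {f h g : ℝ → ℝ} {M : ℝ}
    (T : TestTriple f h g M) (hf : ContDiff ℝ (⊤ : ℕ∞) f) :
    ∫ x, levyGen ση2 γη σU2 γU νη νU f x ∂μ = 0 := by
  let χ : ContDiffBump (0 : ℝ) := ⟨1, 2, one_pos, one_lt_two⟩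
  have hχ : ContDiff ℝ (⊤ : ℕ∞) χ := χ.contDiff
  have hχ1 : ContDiff ℝ (⊤ : ℕ∞) (deriv χ) := (contDiff_infty_iff_deriv.1 hχ).2
  have hχ2 : ContDiff ℝ (⊤ : ℕ∞) (deriv (deriv χ)) := (contDiff_infty_iff_deriv.1 hχ1).2
  have hs : HasCompactSupport χ := χ.hasCompactSupport
  obtain ⟨N, S⟩ := exists_testTriple (f := χ) (h := deriv χ) (g := deriv (deriv χ))
    (fun x => (hχ.differentiable (by simp) x).hasDerivAt)
    (fun x => (hχ1.differentiable (by simp) x).hasDerivAt) hχ2.continuous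
    (hs.exists_bound_of_continuous hχ.continuous) hs.deriv hs.deriv.deriv
  have S0 := S.cont0
  have S1 := S.cont1
  have S2 := S.cont
  have hχ0 : χ (0 : ℝ) = 1 := χ.one_of_mem_closedBall (by simp [χ])
  let a : ℕ → ℝ := fun n => 1 / ((n : ℝ) + 1)
  have ha0 : ∀ n, 0 < a n := fun n => Nat.one_div_pos_of_nat
  have ha1 : ∀ n, a n ≤ 1 := fun n => by
    simp only [a]
    rw [div_le_one (by positivity)]
    simp
  have hat : Tendsto a atTop (nhds 0) := tendsto_one_div_add_atTop_nhds_zero_nat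
  have key := tendsto_integral_levyGen ση2 γη σU2 γU hνη hνU μ
    (fun n => T.mul_rescale S (ha0 n).le (ha1 n)) T
    (fun x => ((by fun_prop : Continuous fun b => f x * χ (x * b)).tendsto' 0 (f x)
      (by simp [hχ0])).comp hat)
    (fun x => ((by fun_prop : Continuous fun b => h x * χ (x * b)
      + f x * (deriv χ (x * b) * b)).tendsto' 0 (h x) (by simp [hχ0])).comp hat)
    (fun x => ((by fun_prop : Continuous fun b => g x * χ (x * b)
      + 2 * (h x * (deriv χ (x * b) * b)) + f x * (deriv (deriv χ) (x * b) * b * b)).tendsto' 0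
      (g x) (by simp [hχ0])).comp hat)
  refine tendsto_nhds_unique key ?_
  have hz : ∀ n, ∫ x, levyGen ση2 γη σU2 γU νη νU (fun x => f x * χ (x * a n)) x ∂μ = 0 := by
    intro n
    refine hinv _ (hf.mul (hχ.comp (by fun_prop))) ?_
    refine HasCompactSupport.mul_left (f := f) ?_
    have : HasCompactSupport (χ ∘ fun x : ℝ => x * a n) :=
      hs.comp_homeomorph (Homeomorph.mulRight₀ (a n) (ha0 n).ne')
    exact this
  simp only [hz]
  exact tendsto_const_nhds

/-! ### Rewriting the auxiliary functions as integrals of one kernel -/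

theorem SUmap_eq (ν : Measure ℝ) (z : ℝ) : SUmap ν z = Smap ν (z - 1) := by
  unfold SUmap Smap
  by_cases h0 : 0 ≤ z
  · rcases lt_trichotomy z 1 with h1 | h1 | h1
    · rw [if_pos ⟨h0, h1⟩, if_neg (by linarith), if_pos (by linarith)]
      congr 2
      ext y
      simp only [mem_Icc, mem_inter_iff, mem_Iic]
      grind
    · simp [h1]
    · rw [if_neg (by grind), if_pos h1, if_pos (by linarith)]
      congr 1 with y
      ring
  · rw [if_neg (by grind), if_neg (by linarith), if_neg (by linarith), if_pos (by linarith)]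
    have : Iic (z - 1) ∩ Icc (-1 : ℝ) 1 = ∅ := by
      ext y
      simp only [mem_inter_iff, mem_Iic, mem_Icc, mem_empty_iff_false]
      grind
    simp [this]

theorem SUmap_of_nonpos (ν : Measure ℝ) {z : ℝ} (hz : z ≤ 0) : SUmap ν z = 0 := by
  rw [SUmap_eq, Smap_eq_integral_kerS]
  have : ∀ y, kerS (z - 1) y = 0 := fun y => by
    unfold kerS
    split_ifs <;> grind
  simp [this]

theorem BUmap_eq {ν : Measure ℝ} (hν : ν (Iio (-1 : ℝ)) = 0) (z : ℝ) :
    BUmap ν z = Bmap ν (z - 1) := by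
  unfold BUmap Bmap
  have : ν (Iio (min (z - 1) (-1))) = 0 :=
    measure_mono_null (Iio_subset_Iio (min_le_right _ _)) hν
  split_ifs <;> first | rfl | linarith | simp [this]

theorem rmu_eq (ν μ : Measure ℝ) (z : ℝ) :
    rmu ν μ z = ∫ x, |x| * Smap ν (z / x - 1) ∂μ := by
  simp_rw [← SUmap_eq]
  unfold rmu
  split_ifs with h1 h2
  · rw [← integral_indicator measurableSet_Ioi]
    congr 1 with x
    by_cases hx : 0 < x
    · simp [hx, abs_of_pos hx]
    · rw [indicator_of_notMem (by simpa using hx),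
        SUmap_of_nonpos ν (div_nonpos_of_nonneg_of_nonpos h1.le (not_lt.1 hx)), mul_zero]
  · rw [← integral_indicator measurableSet_Iio]
    congr 1 with x
    by_cases hx : x < 0
    · simp [hx]
    · rw [indicator_of_notMem (by simpa using hx),
        SUmap_of_nonpos ν (div_nonpos_of_nonpos_of_nonneg h2.le (not_lt.1 hx)), mul_zero]
  · obtain rfl : z = 0 := le_antisymm (not_lt.1 h1) (not_lt.1 h2)
    simp [SUmap_of_nonpos]

theorem kmu_eq {ν : Measure ℝ} (hν : ν (Iio (-1 : ℝ)) = 0) (μ : Measure ℝ) (t : ℝ) :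
    kmu ν μ t = ∫ x, x / |x| * Bmap ν (t / x - 1) ∂μ := by
  simp_rw [← BUmap_eq hν]
  have h0 : ∀ z, ¬ 1 < z → BUmap ν z = 0 := fun z hz => by simp [BUmap, hz]
  unfold kmu
  split_ifs with h1 h2
  · rw [← integral_indicator measurableSet_Ioc]
    congr 1 with x
    by_cases hx : x ∈ Ioc 0 t
    · rw [indicator_of_mem hx, abs_of_pos hx.1, div_self hx.1.ne', one_mul]
    · rw [indicator_of_notMem hx, h0, mul_zero]
      intro h
      have hx0 : 0 < x := by
        by_contra hx0
        linarith [div_nonpos_of_nonneg_of_nonpos h1.le (not_lt.1 hx0)]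
      rw [one_lt_div hx0] at h
      exact hx ⟨hx0, h.le⟩
  · rw [← integral_indicator measurableSet_Ico, ← integral_neg]
    congr 1 with x
    by_cases hx : x ∈ Ico t 0
    · rw [indicator_of_mem hx, abs_of_neg hx.2, div_neg, div_self hx.2.ne, neg_one_mul]
    · rw [indicator_of_notMem hx, h0, mul_zero, neg_zero]
      intro h
      have hx0 : x < 0 := by
        by_contra hx0
        linarith [div_nonpos_of_nonpos_of_nonneg h2.le (not_lt.1 hx0)]
      rw [one_lt_div_of_neg hx0] at h
      exact hx ⟨h.le, hx0⟩
  · obtain rfl : t = 0 := le_antisymm (not_lt.1 h1) (not_lt.1 h2)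
    simp [h0]

theorem Dmu_eq (γη γU : ℝ) (μ : Measure ℝ) (z : ℝ) :
    Dmu γη γU μ z = ∫ x in (0 : ℝ)..z, (γη + x * γU) ∂μ := by
  unfold Dmu
  split_ifs with h
  · rw [intervalIntegral.integral_of_le h]
  · rw [intervalIntegral.integral_of_ge (not_le.1 h).le]

/-! ### Integration by parts against a measure -/

theorem exists_forall_abs_gt_eq_zero {g : ℝ → ℝ} (hg : HasCompactSupport g) :
    ∃ R, 0 < R ∧ ∀ x, R < |x| → g x = 0 := by
  obtain ⟨R, hR, h⟩ := hg.isCompact.isBounded.exists_pos_norm_le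
  refine ⟨R, hR, fun x hx => ?_⟩
  by_contra hne
  exact absurd (h x (subset_tsupport g hne)) (not_le.2 hx)

/-- Kernel expressing a compactly supported function through its derivative. -/
def kerD (z x : ℝ) : ℝ := if 0 < x ∧ x ≤ z then -1 else if z < x ∧ x ≤ 0 then 1 else 0

theorem measurable_kerD : Measurable (Function.uncurry kerD) := by
  unfold Function.uncurry kerD
  refine Measurable.ite ?_ (by fun_prop) (Measurable.ite ?_ (by fun_prop) (by fun_prop))
  · exact (measurableSet_lt measurable_const measurable_snd).inter
      (measurableSet_le measurable_snd measurable_fst)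
  · exact (measurableSet_lt measurable_fst measurable_snd).inter
      (measurableSet_le measurable_snd measurable_const)

theorem integral_kerD_mul (m : Measure ℝ) (q : ℝ → ℝ) (z : ℝ) :
    ∫ x, kerD z x * q x ∂m = -∫ x in (0 : ℝ)..z, q x ∂m := by
  rcases le_total 0 z with h | h
  · rw [intervalIntegral.integral_of_le h, ← integral_indicator measurableSet_Ioc, ← integral_neg]
    congr 1 with x
    simp only [kerD, indicator, mem_Ioc]
    split_ifs <;> grind
  · rw [intervalIntegral.integral_of_ge h, ← integral_indicator measurableSet_Ioc, neg_neg]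
    congr 1 with x
    simp only [kerD, indicator, mem_Ioc]
    split_ifs <;> grind

theorem integral_mul_kerD {h g : ℝ → ℝ} (hh : ∀ x, HasDerivAt h (g x) x) (hg : Continuous g)
    (hs : HasCompactSupport h) (x : ℝ) : ∫ z, g z * kerD z x = h x := by
  have e : deriv h = g := funext fun x => (hh x).deriv
  have hc : ContDiff ℝ 1 h :=
    contDiff_one_iff_deriv.2 ⟨fun x => (hh x).differentiableAt, e ▸ hg⟩
  by_cases hx : 0 < x
  · have e1 : (fun z => g z * kerD z x) = (Ici x).indicator (fun z => -g z) := by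
      ext z
      simp only [kerD, indicator, mem_Ici]
      split_ifs <;> grind
    rw [e1, integral_indicator measurableSet_Ici, integral_Ici_eq_integral_Ioi, integral_neg, ← e,
      hs.integral_Ioi_deriv_eq hc, neg_neg]
  · have e1 : (fun z => g z * kerD z x) = (Iio x).indicator g := by
      ext z
      simp only [kerD, indicator, mem_Iio]
      split_ifs <;> grind
    rw [e1, integral_indicator measurableSet_Iio, ← integral_Iic_eq_integral_Iio, ← e,
      hs.integral_Iic_deriv_eq hc]

theorem integrable_mul_kerD_mul {m : Measure ℝ} [SFinite m] {q g : ℝ → ℝ} (hqm : Measurable q)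
    (hq : ∀ R, IntegrableOn q (Icc (-R) R) m) (hg : Continuous g) (hgs : HasCompactSupport g) :
    Integrable (Function.uncurry fun z x => g z * (kerD z x * q x)) (volume.prod m) := by
  obtain ⟨R, -, hR⟩ := exists_forall_abs_gt_eq_zero hgs
  refine ((hg.integrable_of_hasCompactSupport hgs).norm.mul_prod
    ((integrable_indicator_iff measurableSet_Icc).2 (hq R)).norm).mono' ?_ ?_
  · exact ((hg.measurable.comp measurable_fst).mul
      (measurable_kerD.mul (hqm.comp measurable_snd))).aestronglyMeasurable
  · refine Eventually.of_forall fun ⟨z, x⟩ => ?_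
    simp only [Function.uncurry_apply_pair, norm_mul]
    by_cases hz : R < |z|
    · simp [hR z hz]
    · refine mul_le_mul_of_nonneg_left ?_ (norm_nonneg _)
      by_cases hx : x ∈ Icc (-R) R
      · rw [indicator_of_mem hx]
        have : ‖kerD z x‖ ≤ 1 := by
          unfold kerD
          split_ifs <;> simp
        exact mul_le_of_le_one_left (norm_nonneg _) this
      · have : kerD z x = 0 := by
          rw [mem_Icc] at hx
          rw [lt_abs] at hz
          unfold kerD
          split_ifs <;> grind
        simp [this]

theorem integrable_mul_primitive {m : Measure ℝ} [SFinite m] {q g : ℝ → ℝ} (hqm : Measurable q)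
    (hq : ∀ R, IntegrableOn q (Icc (-R) R) m) (hg : Continuous g) (hgs : HasCompactSupport g) :
    Integrable (fun z => g z * ∫ x in (0 : ℝ)..z, q x ∂m) := by
  have := (integrable_mul_kerD_mul hqm hq hg hgs).integral_prod_left
  simp only [Function.uncurry_apply_pair, integral_const_mul, integral_kerD_mul, mul_neg] at this
  simpa using this.neg

theorem integral_mul_eq_neg_integral_primitive {m : Measure ℝ} [SFinite m] {q h g : ℝ → ℝ}
    (hqm : Measurable q) (hq : ∀ R, IntegrableOn q (Icc (-R) R) m) (hg : Continuous g)
    (hgs : HasCompactSupport g) (hh : ∀ x, HasDerivAt h (g x) x) (hs : HasCompactSupport h) :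
    ∫ x, h x * q x ∂m = -∫ z, g z * ∫ x in (0 : ℝ)..z, q x ∂m := by
  have := integral_integral_swap (integrable_mul_kerD_mul hqm hq hg hgs)
  simp only [integral_const_mul, integral_kerD_mul, mul_neg, integral_neg] at this
  rw [this]
  refine integral_congr_ae (Eventually.of_forall fun x => ?_)
  simp only [← mul_assoc, integral_mul_const, integral_mul_kerD hh hg hs]

/-! ### Joint integrability of the kernels -/

section Fubini

variable {ν μ : Measure ℝ} [IsFiniteMeasure μ] {g : ℝ → ℝ}

theorem integrable_mul_Smap_sub (hν : IsLevyMeasure ν) (hg : Continuous g)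
    (hgs : HasCompactSupport g) :
    Integrable (Function.uncurry fun x z => g z * Smap ν (z - x)) (μ.prod volume) := by
  obtain ⟨C, hC⟩ := hgs.exists_bound_of_continuous hg
  have hm := measurable_Smap hν
  refine Integrable.bdd_mul (c := C) (f := fun p : ℝ × ℝ => g p.2)
    (g := fun p : ℝ × ℝ => Smap ν (p.2 - p.1)) ?_ (by fun_prop)
    (Eventually.of_forall fun p => hC p.2)
  have hmk : Measurable (fun p : ℝ × ℝ => Smap ν (p.2 - p.1)) := by fun_prop
  rw [integrable_prod_iff hmk.aestronglyMeasurable]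
  refine ⟨Eventually.of_forall fun x => (integrable_Smap hν).comp_sub_right x, ?_⟩
  simp only [integral_sub_right_eq_self (fun z => ‖Smap ν z‖)]
  exact integrable_const _

theorem integrable_mul_bounded {k : ℝ → ℝ → ℝ} (hk : Measurable (Function.uncurry k)) {C : ℝ}
    (hC : ∀ x z, |k x z| ≤ C) (hg : Continuous g) (hgs : HasCompactSupport g) :
    Integrable (Function.uncurry fun x z => g z * k x z) (μ.prod volume) := by
  refine Integrable.mul_bdd (c := C) (f := fun p : ℝ × ℝ => g p.2) ?_ hk.aestronglyMeasurable
    (Eventually.of_forall fun p => hC p.1 p.2)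
  exact (hg.integrable_of_hasCompactSupport hgs).comp_snd μ

theorem integrable_mul_Smap_div (hν : IsLevyMeasure ν) (hg : Continuous g)
    (hgs : HasCompactSupport g) :
    Integrable (Function.uncurry fun x z => g z * (|x| * Smap ν (z / x - 1)))
      (μ.prod volume) := by
  obtain ⟨C, hC⟩ := hgs.exists_bound_of_continuous hg
  obtain ⟨R, hR0, hR⟩ := exists_forall_abs_gt_eq_zero hgs
  have hm := measurable_Smap hν
  have hgi : Integrable g := hg.integrable_of_hasCompactSupport hgs
  have hC0 : 0 ≤ C := (norm_nonneg _).trans (hC 0)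
  have hmk : Measurable (Function.uncurry fun x z => g z * (|x| * Smap ν (z / x - 1))) := by
    unfold Function.uncurry
    fun_prop
  have hSi : ∀ x : ℝ, x ≠ 0 → Integrable (fun z => Smap ν (z / x - 1)) := fun x hx =>
    ((integrable_Smap hν).comp_sub_right 1).comp_div hx
  rw [integrable_prod_iff hmk.aestronglyMeasurable]
  constructor
  · refine Eventually.of_forall fun x => ?_
    rcases eq_or_ne x 0 with rfl | hx
    · simp
    · exact ((hSi x hx).const_mul |x|).bdd_mul (c := C) (f := g) hg.aestronglyMeasurable
        (Eventually.of_forall hC)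
  · set N := ν.real (Icc (-1) (-1 / 2)) with hN
    have hfin : ν (Icc (-1) (-1 / 2)) < ⊤ := hν.measure_lt_top (r := 1 / 2) (by norm_num)
      fun y hy => by rw [le_abs]; right; linarith [hy.2]
    have hsmall : ∀ w, w < -1 / 2 → Smap ν w ≤ |1 + w| * N := by
      intro w hw
      rw [Smap_eq_integral_kerS]
      refine (le_abs_self _).trans ?_
      have hi : Integrable ((Icc (-1 : ℝ) (-1 / 2)).indicator fun _ => |1 + w|) ν :=
        (integrable_indicator_iff measurableSet_Icc).2 (integrableOn_const hfin.ne)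
      have := norm_integral_le_of_norm_le (f := fun y => kerS w y) hi
        (Eventually.of_forall fun y => by
          rw [Real.norm_eq_abs, abs_of_nonneg (kerS_nonneg w y)]
          have := le_abs_self (1 + w)
          have := abs_nonneg (1 + w)
          unfold kerS indicator
          simp only [mem_Icc]
          split_ifs <;> grind)
      rw [integral_indicator measurableSet_Icc, setIntegral_const, smul_eq_mul, mul_comm] at this
      exact this
    have hI : 0 ≤ ∫ w, Smap ν w := integral_nonneg (Smap_nonneg ν)
    have hgI : 0 ≤ ∫ z, |g z| := integral_nonneg fun z => abs_nonneg _
    refine Integrable.of_bound hmk.norm.stronglyMeasurable.integral_prod_right.aestronglyMeasurable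
      (C * (4 * R ^ 2) * (∫ w, Smap ν w) + (∫ z, |g z|) * (R * N))
      (Eventually.of_forall fun x => ?_)
    have hpos : 0 ≤ ∫ z, ‖Function.uncurry (fun x z => g z * (|x| * Smap ν (z / x - 1))) (x, z)‖ :=
      integral_nonneg fun z => norm_nonneg _
    rw [Real.norm_of_nonneg hpos]
    simp only [Function.uncurry_apply_pair, norm_mul, Real.norm_eq_abs, abs_abs,
      abs_of_nonneg (Smap_nonneg ν _)]
    rcases eq_or_ne x 0 with rfl | hx
    · simp only [abs_zero, zero_mul, mul_zero, integral_zero]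
      positivity
    rcases le_or_gt |x| (2 * R) with hx2 | hx2
    · have h1 : ∫ z, |g z| * (|x| * Smap ν (z / x - 1))
          ≤ ∫ z, C * |x| * Smap ν (z / x - 1) := by
        refine integral_mono_of_nonneg (Eventually.of_forall fun z => ?_)
          ((hSi x hx).const_mul _) (Eventually.of_forall fun z => ?_)
        · have := Smap_nonneg ν (z / x - 1)
          simp only [Pi.zero_apply]
          positivity
        · simp only [mul_assoc]
          exact mul_le_mul_of_nonneg_right (hC z)
            (mul_nonneg (abs_nonneg x) (Smap_nonneg ν _))
      rw [integral_const_mul, Measure.integral_comp_div (fun z => Smap ν (z - 1)) x,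
        integral_sub_right_eq_self (Smap ν), smul_eq_mul] at h1
      have h2 : |x| * |x| ≤ 4 * R ^ 2 := by nlinarith [abs_nonneg x]
      have h3 : C * (|x| * |x|) * (∫ w, Smap ν w) ≤ C * (4 * R ^ 2) * ∫ w, Smap ν w := by
        gcongr
      have h4 : 0 ≤ (∫ z, |g z|) * (R * N) := by positivity
      calc _ ≤ _ := h1
        _ = C * (|x| * |x|) * (∫ w, Smap ν w) := by ring
        _ ≤ _ := by linarith
    · have h1 : ∫ z, |g z| * (|x| * Smap ν (z / x - 1)) ≤ ∫ z, |g z| * (R * N) := by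
        refine integral_mono_of_nonneg (Eventually.of_forall fun z => ?_)
          (hgi.abs.mul_const _) (Eventually.of_forall fun z => ?_)
        · have := Smap_nonneg ν (z / x - 1)
          simp only [Pi.zero_apply]
          positivity
        · by_cases hz : R < |z|
          · simp [hR z hz]
          · refine mul_le_mul_of_nonneg_left ?_ (abs_nonneg _)
            have hzx : |z / x| < 1 / 2 := by
              rw [abs_div, div_lt_iff₀ (by positivity)]
              linarith
            have h5 := hsmall (z / x - 1) (by linarith [(abs_lt.1 hzx).2])
            rw [add_sub_cancel, abs_div] at h5
            have hN0 : 0 ≤ N := measureReal_nonneg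
            calc |x| * Smap ν (z / x - 1) ≤ |x| * (|z| / |x| * N) := by gcongr
              _ = |z| * N := by field_simp
              _ ≤ R * N := by gcongr; exact not_lt.1 hz
      rw [integral_mul_const] at h1
      have h4 : 0 ≤ C * (4 * R ^ 2) * ∫ w, Smap ν w := by positivity
      linarith

end Fubini

/-! ### The generator in dual form -/

theorem restrict_Ici_eq {ν : Measure ℝ} (hν : ν (Iio (-1 : ℝ)) = 0) :
    ν.restrict (Ici (-1)) = ν := by
  refine Measure.restrict_eq_self_of_ae_mem ?_
  rw [ae_iff]
  convert hν using 2
  ext y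
  simp

namespace TestTriple

variable {f h g : ℝ → ℝ} {M : ℝ}

theorem integral_jump_add_eq (T : TestTriple f h g M) (hs : HasCompactSupport h) {ν : Measure ℝ}
    (hν : IsLevyMeasure ν) (x : ℝ) :
    ∫ y, (f (x + y) - f x - (if |y| ≤ 1 then y * h x else 0)) ∂ν
      = (∫ z, g z * Smap ν (z - x)) + ∫ z, h z * Bmap ν (z - x) := by
  have hi : Integrable h := T.cont1.integrable_of_hasCompactSupport hs
  have key := integral_jump_eq hν (F := fun w => f (x + w)) (H := fun w => h (x + w))
      (G := fun w => g (x + w)) (fun w => (T.deriv1 (x + w)).comp_const_add x w)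
      (fun w => (T.deriv2 (x + w)).comp_const_add x w)
      (T.cont.comp (by fun_prop)) ⟨M, fun w => T.bound2 _⟩ (hi.comp_add_left x)
  simp only [add_zero] at key
  rw [key, ← integral_sub_right_eq_self (fun w => g (x + w) * Smap ν w) x,
    ← integral_sub_right_eq_self (fun w => h (x + w) * Bmap ν w) x]
  simp only [add_sub_cancel]

theorem integral_jump_mul_eq (T : TestTriple f h g M) (hs : HasCompactSupport h) {ν : Measure ℝ}
    (hν : IsLevyMeasure ν) (x : ℝ) :
    ∫ y, (f (x + x * y) - f x - (if |y| ≤ 1 then x * y * h x else 0)) ∂ν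
      = (∫ z, g z * (|x| * Smap ν (z / x - 1)))
        + ∫ z, h z * (x / |x| * Bmap ν (z / x - 1)) := by
  rcases eq_or_ne x 0 with rfl | hx
  · simp
  have hi : Integrable h := T.cont1.integrable_of_hasCompactSupport hs
  have hd : ∀ w, HasDerivAt (fun w => x + x * w) x w := fun w => by
    simpa using ((hasDerivAt_id' w).const_mul x).const_add x
  have key := integral_jump_eq hν (F := fun w => f (x + x * w)) (H := fun w => h (x + x * w) * x)
    (G := fun w => g (x + x * w) * x * x) (fun w => (T.deriv1 (x + x * w)).comp w (hd w))
    (fun w => ((T.deriv2 (x + x * w)).comp w (hd w)).mul_const x)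
    (((T.cont.comp (by fun_prop)).mul continuous_const).mul continuous_const)
    ⟨M * |x| * |x|, fun w => by
      rw [abs_mul, abs_mul]
      gcongr
      exact T.bound2 _⟩
    (((hi.comp_add_left x).comp_mul_left' hx).mul_const x)
  simp only [mul_zero, add_zero] at key
  have hsub : ∀ φ : ℝ → ℝ, ∫ z, φ (z / x - 1) = |x| * ∫ w, φ w := fun φ => by
    rw [Measure.integral_comp_div (fun z => φ (z - 1)) x, integral_sub_right_eq_self φ, smul_eq_mul]
  have e : ∀ z, x + x * (z / x - 1) = z := fun z => by field_simp; ring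
  have hS := hsub (fun w => g (x + x * w) * Smap ν w)
  have hB := hsub (fun w => h (x + x * w) * Bmap ν w)
  simp only [e] at hS hB
  simp only [mul_left_comm _ |x|, mul_left_comm _ (x / |x|), integral_const_mul]
  rw [hS, hB, ← mul_assoc, abs_mul_abs_self, ← mul_assoc, div_mul_cancel₀ _ (abs_ne_zero.2 hx),
    ← integral_const_mul, ← integral_const_mul]
  have e1 : ∀ y, x * y * h x = y * (h x * x) := fun y => by ring
  have e2 : ∀ w, x * x * (g (x + x * w) * Smap ν w) = g (x + x * w) * x * x * Smap ν w :=
    fun w => by ring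
  have e3 : ∀ w, x * (h (x + x * w) * Bmap ν w) = h (x + x * w) * x * Bmap ν w :=
    fun w => by ring
  simp only [e1, e2, e3]
  exact key

end TestTriple

/-- The density part of the functional on the right-hand side. -/
def dualDensity (γη γU : ℝ) (νη νU μ : Measure ℝ) (z : ℝ) : ℝ :=
  convM (Smap νη) μ z + rmu νU μ z
    - (Dmu γη γU μ z + (∫ x in (0 : ℝ)..z, convM (Bmap νη) μ x) + ∫ t in (0 : ℝ)..z, kmu νU μ t)

section Dual

variable {γη γU : ℝ} {νη νU μ : Measure ℝ} [IsFiniteMeasure μ] {g : ℝ → ℝ}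

theorem integrable_mul_convM_Smap (hνη : IsLevyMeasure νη) (hg : Continuous g)
    (hgs : HasCompactSupport g) : Integrable (fun z => g z * convM (Smap νη) μ z) := by
  simpa only [Function.uncurry_apply_pair, integral_const_mul, convM] using
    (integrable_mul_Smap_sub (μ := μ) hνη hg hgs).integral_prod_right

theorem integrable_mul_rmu (hνU : IsLevyMeasure νU) (hg : Continuous g)
    (hgs : HasCompactSupport g) : Integrable (fun z => g z * rmu νU μ z) := by
  simpa only [Function.uncurry_apply_pair, integral_const_mul, ← rmu_eq] using
    (integrable_mul_Smap_div (μ := μ) hνU hg hgs).integral_prod_right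

theorem integrableOn_Icc_of_bounded {m : Measure ℝ} [IsFiniteMeasureOnCompacts m] {q : ℝ → ℝ}
    (hq : Measurable q) {C : ℝ} (hC : ∀ x, |q x| ≤ C) (R : ℝ) :
    IntegrableOn q (Icc (-R) R) m :=
  Measure.integrableOn_of_bounded isCompact_Icc.measure_ne_top hq.aestronglyMeasurable
    (Eventually.of_forall hC)

theorem measurable_Bmap_sub (hνη : IsLevyMeasure νη) :
    Measurable (Function.uncurry fun x z => Bmap νη (z - x)) :=
  (measurable_Bmap hνη).comp (measurable_snd.sub measurable_fst)

theorem measurable_Bmap_div (hνU : IsLevyMeasure νU) :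
    Measurable (Function.uncurry fun x z => x / |x| * Bmap νU (z / x - 1)) := by
  have := measurable_Bmap hνU
  unfold Function.uncurry
  fun_prop

theorem abs_div_abs_mul_le {C : ℝ} (x : ℝ) {b : ℝ} (hb : |b| ≤ C) : |x / |x| * b| ≤ C := by
  rw [abs_mul, abs_div, abs_abs]
  exact (mul_le_of_le_one_left (abs_nonneg b) (div_self_le_one _)).trans hb

theorem measurable_convM_Bmap (hνη : IsLevyMeasure νη) : Measurable (convM (Bmap νη) μ) :=
  (measurable_Bmap_sub hνη).stronglyMeasurable.integral_prod_left.measurable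

theorem measurable_kmu (hνU : IsLevyMeasure νU) (hconc : νU (Iio (-1 : ℝ)) = 0) :
    Measurable (kmu νU μ) := by
  rw [funext (kmu_eq hconc μ)]
  exact (measurable_Bmap_div hνU).stronglyMeasurable.integral_prod_left.measurable

theorem integrableOn_convM_Bmap (hνη : IsLevyMeasure νη) (R : ℝ) :
    IntegrableOn (convM (Bmap νη) μ) (Icc (-R) R) := by
  obtain ⟨C, hC⟩ := exists_abs_Bmap_le hνη
  refine integrableOn_Icc_of_bounded (measurable_convM_Bmap hνη) (C := C * μ.real univ)
    (fun z => ?_) R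
  exact norm_integral_le_of_norm_le_const (f := fun x => Bmap νη (z - x))
    (Eventually.of_forall fun x => hC (z - x))

theorem integrableOn_kmu (hνU : IsLevyMeasure νU) (hconc : νU (Iio (-1 : ℝ)) = 0) (R : ℝ) :
    IntegrableOn (kmu νU μ) (Icc (-R) R) := by
  obtain ⟨C, hC⟩ := exists_abs_Bmap_le hνU
  refine integrableOn_Icc_of_bounded (measurable_kmu hνU hconc) (C := C * μ.real univ)
    (fun z => ?_) R
  rw [kmu_eq hconc]
  exact norm_integral_le_of_norm_le_const (f := fun x => x / |x| * Bmap νU (z / x - 1))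
    (Eventually.of_forall fun x => abs_div_abs_mul_le x (hC _))

theorem integrableOn_drift (R : ℝ) : IntegrableOn (fun x => γη + x * γU) (Icc (-R) R) μ :=
  (by fun_prop : Continuous fun x : ℝ => γη + x * γU).continuousOn.integrableOn_compact isCompact_Icc

theorem integrable_mul_primitives (hνη : IsLevyMeasure νη) (hνU : IsLevyMeasure νU)
    (hconc : νU (Iio (-1 : ℝ)) = 0) (hg : Continuous g) (hgs : HasCompactSupport g) :
    Integrable (fun z => g z * Dmu γη γU μ z) ∧
    Integrable (fun z => g z * ∫ x in (0 : ℝ)..z, convM (Bmap νη) μ x) ∧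
    Integrable (fun z => g z * ∫ x in (0 : ℝ)..z, kmu νU μ x) := by
  refine ⟨?_, ?_, ?_⟩
  · simp only [Dmu_eq]
    exact integrable_mul_primitive (by fun_prop) integrableOn_drift hg hgs
  · exact integrable_mul_primitive (measurable_convM_Bmap hνη) (integrableOn_convM_Bmap hνη) hg hgs
  · exact integrable_mul_primitive (measurable_kmu hνU hconc) (integrableOn_kmu hνU hconc) hg hgs

theorem integrable_mul_jumpDensity (hνη : IsLevyMeasure νη) (hνU : IsLevyMeasure νU)
    (hg : Continuous g) (hgs : HasCompactSupport g) :
    Integrable (fun z => g z * (convM (Smap νη) μ z + rmu νU μ z)) := by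
  simp only [mul_add]
  exact (integrable_mul_convM_Smap hνη hg hgs).add (integrable_mul_rmu hνU hg hgs)

theorem integrable_mul_driftDensity (hνη : IsLevyMeasure νη) (hνU : IsLevyMeasure νU)
    (hconc : νU (Iio (-1 : ℝ)) = 0) (hg : Continuous g) (hgs : HasCompactSupport g) :
    Integrable (fun z => g z * (Dmu γη γU μ z + (∫ x in (0 : ℝ)..z, convM (Bmap νη) μ x)
      + ∫ t in (0 : ℝ)..z, kmu νU μ t)) := by
  obtain ⟨h3, h4, h5⟩ := integrable_mul_primitives (γη := γη) (γU := γU) (μ := μ) hνη hνU hconc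
    hg hgs
  simp only [mul_add]
  exact (h3.add h4).add h5

theorem integrable_mul_dualDensity (hνη : IsLevyMeasure νη) (hνU : IsLevyMeasure νU)
    (hconc : νU (Iio (-1 : ℝ)) = 0) (hg : Continuous g) (hgs : HasCompactSupport g) :
    Integrable (fun z => g z * dualDensity γη γU νη νU μ z) := by
  simp only [dualDensity, mul_sub]
  exact (integrable_mul_jumpDensity hνη hνU hg hgs).sub
    (integrable_mul_driftDensity hνη hνU hconc hg hgs)

theorem integral_mul_dualDensity (hνη : IsLevyMeasure νη) (hνU : IsLevyMeasure νU)
    (hconc : νU (Iio (-1 : ℝ)) = 0) (hg : Continuous g) (hgs : HasCompactSupport g) :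
    ∫ z, g z * dualDensity γη γU νη νU μ z
      = (∫ z, g z * (convM (Smap νη) μ z + rmu νU μ z))
          - ∫ z, g z * (Dmu γη γU μ z + (∫ x in (0 : ℝ)..z, convM (Bmap νη) μ x)
              + ∫ t in (0 : ℝ)..z, kmu νU μ t) := by
  simp only [dualDensity, mul_sub]
  exact integral_sub (integrable_mul_jumpDensity hνη hνU hg hgs)
    (integrable_mul_driftDensity hνη hνU hconc hg hgs)

/-- Integrating the generator against `μ` amounts to applying the dual functional to `f''`. -/
theorem TestTriple.integral_levyGen {f h : ℝ → ℝ} {M : ℝ} (T : TestTriple f h g M)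
    (hs : HasCompactSupport h) (hgs : HasCompactSupport g) (ση2 σU2 : ℝ)
    (hνη : IsLevyMeasure νη) (hνU : IsLevyMeasure νU) (hconc : νU (Iio (-1 : ℝ)) = 0) :
    ∫ x, levyGen ση2 γη σU2 γU νη νU f x ∂μ
      = (∫ z, g z * (ση2 / 2 + z ^ 2 * σU2 / 2) ∂μ)
        + ∫ z, g z * dualDensity γη γU νη νU μ z := by
  obtain ⟨Cη, hCη⟩ := exists_abs_Bmap_le hνη
  obtain ⟨CU, hCU⟩ := exists_abs_Bmap_le hνU
  have hg := T.cont
  have hh := T.cont1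
  have pS := integrable_mul_Smap_sub (μ := μ) hνη hg hgs
  have pr := integrable_mul_Smap_div (μ := μ) hνU hg hgs
  have pB := integrable_mul_bounded (μ := μ) (measurable_Bmap_sub hνη)
    (fun x z => hCη (z - x)) hh hs
  have pk := integrable_mul_bounded (μ := μ) (measurable_Bmap_div hνU)
    (fun x z => abs_div_abs_mul_le x (hCU (z / x - 1))) hh hs
  have iD : Integrable (fun x => h x * (γη + x * γU)) μ :=
    (by fun_prop : Continuous fun x => h x * (γη + x * γU)).integrable_of_hasCompactSupport
      hs.mul_right
  have iσ : Integrable (fun x => g x * (ση2 / 2 + x ^ 2 * σU2 / 2)) μ :=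
    (by fun_prop : Continuous fun x => g x * (ση2 / 2 + x ^ 2 * σU2 / 2)).integrable_of_hasCompactSupport
      hgs.mul_right
  have e : ∀ x, levyGen ση2 γη σU2 γU νη νU f x = h x * (γη + x * γU)
      + g x * (ση2 / 2 + x ^ 2 * σU2 / 2)
      + (∫ z, g z * Smap νη (z - x)) + (∫ z, h z * Bmap νη (z - x))
      + (∫ z, g z * (|x| * Smap νU (z / x - 1)))
      + ∫ z, h z * (x / |x| * Bmap νU (z / x - 1)) := by
    intro x
    rw [T.levyGen_eq, restrict_Ici_eq hconc, T.integral_jump_add_eq hs hνη,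
      T.integral_jump_mul_eq hs hνU]
    ring
  have iS := pS.integral_prod_left
  have iB := pB.integral_prod_left
  have ir := pr.integral_prod_left
  have ik := pk.integral_prod_left
  simp only [Function.uncurry_apply_pair] at iS iB ir ik
  have i2 := iD.add iσ
  have i3 := i2.add iS
  have i4 := i3.add iB
  have i5 := i4.add ir
  have a3 := integral_add i2 iS
  have a4 := integral_add i3 iB
  have a5 := integral_add i4 ir
  have a6 := integral_add i5 ik
  simp only [Pi.add_apply] at a3 a4 a5 a6
  simp only [e]
  rw [a6, a5, a4, a3, integral_add iD iσ,
    integral_integral_swap pS, integral_integral_swap pB, integral_integral_swap pr,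
    integral_integral_swap pk]
  simp only [integral_const_mul, ← rmu_eq, ← kmu_eq hconc]
  obtain ⟨h3, h4, h5⟩ := integrable_mul_primitives (γη := γη) (γU := γU) (μ := μ) hνη hνU hconc
    hg hgs
  rw [integral_mul_dualDensity hνη hνU hconc hg hgs]
  have qB := integral_mul_eq_neg_integral_primitive (measurable_convM_Bmap (μ := μ) hνη)
    (integrableOn_convM_Bmap hνη) hg hgs T.deriv2 hs
  have qk := integral_mul_eq_neg_integral_primitive (measurable_kmu (μ := μ) hνU hconc)
    (integrableOn_kmu hνU hconc) hg hgs T.deriv2 hs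
  have qD := integral_mul_eq_neg_integral_primitive (q := fun x => γη + x * γU) (m := μ)
    (by fun_prop) integrableOn_drift hg hgs T.deriv2 hs
  simp only [← Dmu_eq] at qD
  have sS : ∫ z, g z * (convM (Smap νη) μ z + rmu νU μ z)
      = (∫ z, g z * convM (Smap νη) μ z) + ∫ z, g z * rmu νU μ z := by
    simp only [mul_add]
    exact integral_add (integrable_mul_convM_Smap hνη hg hgs) (integrable_mul_rmu hνU hg hgs)
  have sD : ∫ z, g z * (Dmu γη γU μ z + (∫ x in (0 : ℝ)..z, convM (Bmap νη) μ x)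
        + ∫ t in (0 : ℝ)..z, kmu νU μ t)
      = (∫ z, g z * Dmu γη γU μ z) + (∫ z, g z * ∫ x in (0 : ℝ)..z, convM (Bmap νη) μ x)
        + ∫ z, g z * ∫ t in (0 : ℝ)..z, kmu νU μ t := by
    simp only [mul_add]
    rw [← integral_add h3 h4]
    exact integral_add (h3.add h4) h5
  rw [sS, sD, qk, qD]
  simp only [convM] at qB ⊢
  rw [qB]
  ring

end Dual

/-! ### Test functions with vanishing integral -/

/-- A compactly supported continuous function of vanishing integral has a compactly supported
primitive. -/
theorem exists_hasCompactSupport_primitive {g : ℝ → ℝ} (hg : Continuous g)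
    (hgs : HasCompactSupport g) (h0 : ∫ z, g z = 0) :
    ∃ h : ℝ → ℝ, (∀ x, HasDerivAt h (g x) x) ∧ HasCompactSupport h := by
  obtain ⟨R, hR0, hR⟩ := exists_forall_abs_gt_eq_zero hgs
  have hi : Integrable g := hg.integrable_of_hasCompactSupport hgs
  refine ⟨fun x => ∫ t in Iic x, g t, fun x => ?_, ?_⟩
  · have e : (fun x => ∫ t in Iic x, g t) = fun x => (∫ t in Iic 0, g t) + ∫ t in (0 : ℝ)..x, g t := by
      funext x
      rw [← intervalIntegral.integral_Iic_sub_Iic hi.integrableOn hi.integrableOn]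
      ring
    rw [e]
    exact (intervalIntegral.integral_hasDerivAt_right (hg.intervalIntegrable _ _)
      (hg.stronglyMeasurableAtFilter _ _) hg.continuousAt).const_add _
  · refine HasCompactSupport.intro (isCompact_Icc (a := -R) (b := R)) fun x hx => ?_
    rcases lt_or_ge x (-R) with hx1 | hx1
    · refine setIntegral_eq_zero_of_forall_eq_zero fun t ht => hR t ?_
      rw [lt_abs]
      right
      linarith [mem_Iic.1 ht]
    · have hx2 : R < x := by
        by_contra hc
        exact hx ⟨hx1, not_lt.1 hc⟩
      rw [← h0]
      refine setIntegral_eq_integral_of_forall_compl_eq_zero fun t ht => hR t ?_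
      rw [lt_abs]
      left
      linarith [not_le.1 (mt mem_Iic.2 ht)]

theorem contDiff_of_hasDerivAt {f h : ℝ → ℝ} (hf : ∀ x, HasDerivAt f (h x) x)
    (hh : ContDiff ℝ (⊤ : ℕ∞) h) : ContDiff ℝ (⊤ : ℕ∞) f := by
  rw [contDiff_infty_iff_deriv, funext fun x => (hf x).deriv]
  exact ⟨fun x => (hf x).differentiableAt, hh⟩

/-- The dual functional of an invariant measure annihilates test functions of vanishing
integral. -/
theorem Invariant.dual_eq_zero {ση2 γη σU2 γU : ℝ} {νη νU μ : Measure ℝ} [IsFiniteMeasure μ]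
    (hinv : Invariant ση2 γη σU2 γU νη νU μ) (hνη : IsLevyMeasure νη) (hνU : IsLevyMeasure νU)
    (hconc : νU (Iio (-1 : ℝ)) = 0) {g : ℝ → ℝ} (hg : ContDiff ℝ (⊤ : ℕ∞) g)
    (hgs : HasCompactSupport g) (h0 : ∫ z, g z = 0) :
    (∫ z, g z * (ση2 / 2 + z ^ 2 * σU2 / 2) ∂μ)
      + ∫ z, g z * dualDensity γη γU νη νU μ z = 0 := by
  obtain ⟨h, hd, hs⟩ := exists_hasCompactSupport_primitive hg.continuous hgs h0
  have hh : ContDiff ℝ (⊤ : ℕ∞) h := contDiff_of_hasDerivAt hd hg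
  have hi : Integrable h := hh.continuous.integrable_of_hasCompactSupport hs
  have hd' : ∀ x, HasDerivAt (fun x => ∫ t in (0 : ℝ)..x, h t) (h x) x := fun x =>
    intervalIntegral.integral_hasDerivAt_right (hh.continuous.intervalIntegrable _ _)
      (hh.continuous.stronglyMeasurableAtFilter _ _) hh.continuous.continuousAt
  obtain ⟨M, T⟩ := exists_testTriple hd' hd hg.continuous
    ⟨∫ t, ‖h t‖, fun x => (intervalIntegral.norm_integral_le_integral_norm_uIoc).trans
      (setIntegral_le_integral hi.norm (Eventually.of_forall fun t => norm_nonneg _))⟩ hs hgs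
  rw [← T.integral_levyGen hs hgs ση2 σU2 hνη hνU hconc]
  exact hinv.integral_levyGen_eq_zero hνη hνU T (contDiff_of_hasDerivAt hd' hh)

/-- A functional `g ↦ ∫ g w dμ + ∫ g p` annihilating test functions of vanishing
integral is a multiple of Lebesgue measure. -/
theorem exists_const_of_annihilates {μ : Measure ℝ} [IsFiniteMeasure μ] {w p : ℝ → ℝ}
    (hw : Continuous w)
    (hp : ∀ g : ℝ → ℝ, Continuous g → HasCompactSupport g → Integrable fun z => g z * p z)
    (h0 : ∀ g : ℝ → ℝ, ContDiff ℝ (⊤ : ℕ∞) g → HasCompactSupport g → ∫ z, g z = 0 →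
      (∫ z, g z * w z ∂μ) + ∫ z, g z * p z = 0) :
    ∃ K : ℝ, ∀ g : ℝ → ℝ, Continuous g → HasCompactSupport g →
      K * (∫ z, g z) = (∫ z, g z * w z ∂μ) + ∫ z, g z * p z := by
  have hiw : ∀ g : ℝ → ℝ, Continuous g → HasCompactSupport g →
      Integrable (fun z => g z * w z) μ := fun g hg hgs =>
    (hg.mul hw).integrable_of_hasCompactSupport hgs.mul_right
  have hi : ∀ g : ℝ → ℝ, Continuous g → HasCompactSupport g → Integrable g :=
    fun g hg hgs => hg.integrable_of_hasCompactSupport hgs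
  let b : ContDiffBump (0 : ℝ) := ⟨1, 2, one_pos, one_lt_two⟩
  let φ : ℝ → ℝ := b.normed volume
  have hφ : ContDiff ℝ (⊤ : ℕ∞) φ := b.contDiff_normed
  have hφs : HasCompactSupport φ := b.hasCompactSupport_normed
  have hφ1 : ∫ z, φ z = 1 := b.integral_normed
  refine ⟨(∫ z, φ z * w z ∂μ) + ∫ z, φ z * p z, ?_⟩
  have smooth : ∀ g : ℝ → ℝ, ContDiff ℝ (⊤ : ℕ∞) g → HasCompactSupport g →
      ((∫ z, φ z * w z ∂μ) + ∫ z, φ z * p z) * (∫ z, g z)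
        = (∫ z, g z * w z ∂μ) + ∫ z, g z * p z := by
    intro g hg hgs
    set c := ∫ z, g z with hc
    have key := h0 (fun z => g z - c * φ z) (hg.sub (contDiff_const.mul hφ))
      (hgs.sub (hφs.mul_left (f := fun _ => c))) (by
        rw [integral_sub (hi g hg.continuous hgs) ((hi φ hφ.continuous hφs).const_mul c),
          integral_const_mul, hφ1, ← hc]
        ring)
    simp only [sub_mul, mul_assoc] at key
    rw [integral_sub (hiw g hg.continuous hgs) ((hiw φ hφ.continuous hφs).const_mul c),
      integral_sub (hp g hg.continuous hgs) ((hp φ hφ.continuous hφs).const_mul c),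
      integral_const_mul, integral_const_mul] at key
    linarith
  intro g hg hgs
  obtain ⟨C, hC⟩ := hgs.exists_bound_of_continuous hg
  obtain ⟨ψ, hψ1, -, hψs, -⟩ := exists_continuous_one_zero_of_isCompact (s := tsupport g) hgs
    isClosed_empty (disjoint_empty _)
  have happrox : ∀ n : ℕ, ∃ G : ℝ → ℝ, ContDiff ℝ (⊤ : ℕ∞) G ∧
      (∀ x, dist (G x) (g x) < 1 / ((n : ℝ) + 1)) ∧ Function.support G ⊆ Function.support g :=
    fun n => hg.exists_contDiff_approx ⊤ continuous_const fun _ => Nat.one_div_pos_of_nat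
  choose G hG hGd hGs using happrox
  have hGc : ∀ n, HasCompactSupport (G n) := fun n => hgs.mono (hGs n)
  have lim : ∀ (m : Measure ℝ) (q : ℝ → ℝ),
      (∀ f : ℝ → ℝ, Continuous f → HasCompactSupport f → Integrable (fun z => f z * q z) m) →
      Tendsto (fun n => ∫ z, G n z * q z ∂m) atTop (nhds (∫ z, g z * q z ∂m)) := by
    intro m q hq
    refine tendsto_integral_of_dominated_convergence (fun z => (C + 1) * ‖ψ z * q z‖)
      (fun n => (hq _ (hG n).continuous (hGc n)).aestronglyMeasurable)
      ((hq ψ ψ.continuous hψs).norm.const_mul _) (fun n => Eventually.of_forall fun z => ?_)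
      (Eventually.of_forall fun z => ?_)
    · by_cases hz : z ∈ Function.support g
      · have h1 : ψ z = 1 := hψ1 (subset_tsupport g hz)
        rw [h1, one_mul, norm_mul]
        refine mul_le_mul_of_nonneg_right ?_ (norm_nonneg _)
        have h2 := (hGd n z).le
        rw [dist_eq_norm] at h2
        have h3 : 1 / ((n : ℝ) + 1) ≤ 1 := by
          rw [div_le_one (by positivity)]
          linarith [(Nat.cast_nonneg n : (0 : ℝ) ≤ n)]
        linarith [norm_le_norm_add_norm_sub' (G n z) (g z), hC z]
      · have h1 : G n z = 0 := Function.notMem_support.1 fun h => hz (hGs n h)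
        have := (norm_nonneg _).trans (hC 0)
        rw [h1, zero_mul, norm_zero]
        positivity
    · refine Tendsto.mul_const _ (tendsto_iff_dist_tendsto_zero.2 ?_)
      exact squeeze_zero (fun n => dist_nonneg) (fun n => (hGd n z).le)
        tendsto_one_div_add_atTop_nhds_zero_nat
  have l1 := lim volume (fun _ => 1) (by simpa only [mul_one] using hi)
  simp only [mul_one] at l1
  refine tendsto_nhds_unique (l1.const_mul _) ?_
  simp only [fun n => smooth (G n) (hG n) (hGc n)]
  exact (lim μ w hiw).add (lim volume p hp)

end KEF

theorem stmt5 (ση2 γη σU2 γU : ℝ) (νη νU : Measure ℝ)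
    (hση : 0 ≤ ση2) (hσU : 0 ≤ σU2)
    (hνη : IsLevyMeasure νη) (hνU : IsLevyMeasure νU)
    (hconc : νU (Iio (-1 : ℝ)) = 0)
    (hnz : ¬(ση2 = 0 ∧ νη = 0 ∧ γη = 0))
    (μ : Measure ℝ) [IsProbabilityMeasure μ]
    (hinv : Invariant ση2 γη σU2 γU νη νU μ) :
    ∃ K : ℝ, ∀ g : ℝ → ℝ, Continuous g → HasCompactSupport g →
      K * (∫ z, g z) =
        (∫ z, g z * (ση2 / 2 + z ^ 2 * σU2 / 2) ∂μ)
          + (∫ z, g z * (convM (Smap νη) μ z + rmu νU μ z))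
          - ∫ z, g z * (Dmu γη γU μ z + (∫ x in (0 : ℝ)..z, convM (Bmap νη) μ x)
              + ∫ t in (0 : ℝ)..z, kmu νU μ t) := by
  obtain ⟨K, hK⟩ := exists_const_of_annihilates (μ := μ)
    (w := fun z => ση2 / 2 + z ^ 2 * σU2 / 2) (p := dualDensity γη γU νη νU μ) (by fun_prop)
    (fun g hg hgs => integrable_mul_dualDensity hνη hνU hconc hg hgs)
    (fun g hg hgs h0 => hinv.dual_eq_zero hνη hνU hconc hg hgs h0)
  refine ⟨K, fun g hg hgs => ?_⟩
  rw [hK g hg hgs, integral_mul_dualDensity hνη hνU hconc hg hgs, add_sub_assoc]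

end
end

section
/- Let (σ_η², ν_η, γ_η) ≠ (0, 0, 0) and (σ_Ũ², ν_Ũ, γ_Ũ) be Lévy triplets with ν_Ũ concentrated on [−1,∞), let μ be an invariant probability measure for the generator A, and assume σ_η² + σ_Ũ² > 0. Then: (i) if σ_η² > 0, μ is absolutely continuous with a density f_μ that is continuous on all of ℝ; (ii) if σ_Ũ² > 0, the restriction of μ to ℝ ∖ {0} is absolutely continuous with a density f_μ that is continuous on ℝ ∖ {0}; (iii) in both cases there exist constants M₁, M₂ > 0 such that (σ_η² + z² σ_Ũ²) f_μ(z) ≤ M₁ + M₂ |z| for all z ≠ 0. -/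
open MeasureTheory Set Filter

noncomputable section

open KEF

namespace KEF

/-- The kernel of the second order Taylor remainder of a function between `x` and `e`. -/
def taylorKernel (x e z : ℝ) : ℝ :=
  if x < z then max (e - z) 0 else if z < x then max (z - e) 0 else 0

/-- The kernel representing `f' x` through `f''` for compactly supported `f`. -/
def stepKernel (x z : ℝ) : ℝ := (if x ≤ z then 1 else 0) - (if x ≤ 0 then 1 else 0)

/-- The kernel representing `f u - f 0` through `f''` for compactly supported `f`. -/
def greenKernel (u z : ℝ) : ℝ :=
  min (max u 0) (max z 0) + min (max (-u) 0) (max (-z) 0)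

theorem integral_add_mul_add_mul {m : Measure ℝ} {a b c : ℝ → ℝ} (ha : Integrable a m)
    (hb : Integrable b m) (hc : Integrable c m) (s t : ℝ) :
    ∫ z, (a z + s * b z + t * c z) ∂m
      = (∫ z, a z ∂m) + s * (∫ z, b z ∂m) + t * ∫ z, c z ∂m := by
  have h : Integrable (fun z => a z + s * b z) m := ha.add (hb.const_mul s)
  rw [integral_add h (hc.const_mul t), integral_add ha (hb.const_mul s), integral_const_mul,
    integral_const_mul]

theorem integral_mul_taylorKernel {f : ℝ → ℝ} (hf : ContDiff ℝ (⊤ : ℕ∞) f) (x e : ℝ) :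
    ∫ z, deriv (deriv f) z * taylorKernel x e z = f e - f x - (e - x) * deriv f x := by
  have h1 : Differentiable ℝ f := hf.differentiable (by simp)
  have hf' : ContDiff ℝ 1 (deriv f) := (contDiff_infty_iff_deriv.1 hf).2.of_le (by simp)
  have h2 : Differentiable ℝ (deriv f) := hf'.differentiable (by norm_num)
  have h3 : Continuous (deriv (deriv f)) := hf'.continuous_deriv le_rfl
  have key : ∫ z in x..e, deriv (deriv f) z * (e - z) = f e - f x - (e - x) * deriv f x := by
    have : ∀ z ∈ uIcc x e, HasDerivAt (fun z => deriv f z * (e - z) + f z)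
        (deriv (deriv f) z * (e - z)) z := by
      intro z _
      have a1 := ((h2 z).hasDerivAt.mul ((hasDerivAt_id z).const_sub e)).add (h1 z).hasDerivAt
      exact a1.congr_deriv (by simp)
    rw [intervalIntegral.integral_eq_sub_of_hasDerivAt this
      ((h3.mul (by fun_prop)).intervalIntegrable _ _)]
    simp; ring
  rw [← key]
  rcases le_total x e with h | h
  · rw [intervalIntegral.integral_of_le h, ← integral_indicator measurableSet_Ioc]
    congr 1; ext z
    by_cases hz : z ∈ Ioc x e
    · rw [indicator_of_mem hz]
      simp only [taylorKernel, if_pos hz.1, max_eq_left (sub_nonneg.2 hz.2)]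
    · rw [indicator_of_notMem hz]
      simp only [mem_Ioc, not_and_or, not_lt, not_le] at hz
      unfold taylorKernel
      split_ifs with h1 h2
      · rw [max_eq_right, mul_zero]; rcases hz with hz | hz <;> linarith
      · rw [max_eq_right, mul_zero]; linarith
      · simp
  · rw [intervalIntegral.integral_symm, intervalIntegral.integral_of_le h,
      integral_Ioc_eq_integral_Ioo, ← integral_neg, ← integral_indicator measurableSet_Ioo]
    congr 1; ext z
    by_cases hz : z ∈ Ioo e x
    · rw [indicator_of_mem hz]
      simp only [taylorKernel, if_pos hz.2, if_neg (not_lt.2 hz.2.le),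
        max_eq_left (sub_nonneg.2 hz.1.le)]
      ring
    · rw [indicator_of_notMem hz]
      simp only [mem_Ioo, not_and_or, not_lt] at hz
      unfold taylorKernel
      split_ifs with h1 h2
      · rw [max_eq_right, mul_zero]; linarith
      · rw [max_eq_right, mul_zero]; rcases hz with hz | hz <;> linarith
      · simp

theorem integral_deriv_eq_zero {g : ℝ → ℝ} (hg : ContDiff ℝ 1 g) (hc : HasCompactSupport g) :
    ∫ z, deriv g z = 0 :=
  integral_eq_zero_of_hasDerivAt_of_integrable
    (fun x => (hg.differentiable (by norm_num) x).hasDerivAt)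
    ((hg.continuous_deriv le_rfl).integrable_of_hasCompactSupport hc.deriv)
    (hg.continuous.integrable_of_hasCompactSupport hc)

theorem integral_deriv_mul_ite_lt {g : ℝ → ℝ} (hg : ContDiff ℝ 1 g) (hc : HasCompactSupport g)
    (x : ℝ) : ∫ z, deriv g z * (if x < z then 1 else 0) = -g x := by
  rw [← hc.integral_Ioi_deriv_eq hg x, ← integral_indicator measurableSet_Ioi]
  congr 1; ext z
  by_cases h : x < z <;> simp [indicator, h]

theorem integrable_deriv_mul_ite_lt {g : ℝ → ℝ} (hg : ContDiff ℝ 1 g) (hc : HasCompactSupport g)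
    (x : ℝ) : Integrable (fun z => deriv g z * (if x < z then 1 else 0)) := by
  have := (((hg.continuous_deriv le_rfl).integrable_of_hasCompactSupport (μ := volume)
    hc.deriv).indicator (measurableSet_Ioi (a := x)))
  refine this.congr (Eventually.of_forall fun z => ?_)
  by_cases h : x < z <;> simp [indicator, h]

theorem integral_mul_stepKernel {g : ℝ → ℝ} (hg : ContDiff ℝ 1 g) (hc : HasCompactSupport g)
    (x : ℝ) : ∫ z, deriv g z * stepKernel x z = -g x := by
  have hi := (hg.continuous_deriv le_rfl).integrable_of_hasCompactSupport (μ := volume) hc.deriv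
  have : (fun z => deriv g z * stepKernel x z) =ᵐ[volume]
      fun z => deriv g z * (if x < z then 1 else 0) - (if x ≤ 0 then 1 else 0) * deriv g z := by
    filter_upwards [(Set.finite_singleton x).countable.ae_notMem volume] with z hz
    have : x ≤ z ↔ x < z := ⟨fun h => lt_of_le_of_ne h (fun h' => hz (by simp [h'])), le_of_lt⟩
    simp only [stepKernel, this]; ring
  rw [integral_congr_ae this, integral_sub (integrable_deriv_mul_ite_lt hg hc x)
    (hi.const_mul _), integral_const_mul, integral_deriv_eq_zero hg hc,
    integral_deriv_mul_ite_lt hg hc]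
  simp

theorem taylorKernel_nonneg (x e z : ℝ) : 0 ≤ taylorKernel x e z := by
  unfold taylorKernel; split_ifs <;> simp

theorem taylorKernel_le (x e z : ℝ) : taylorKernel x e z ≤ |e - x| := by
  unfold taylorKernel
  split_ifs
  · exact max_le (by linarith [le_abs_self (e - x)]) (abs_nonneg _)
  · exact max_le (by linarith [neg_abs_le (e - x)]) (abs_nonneg _)
  · exact abs_nonneg _

theorem measurable_taylorKernel {Ω : Type*} [MeasurableSpace Ω] {X E Z : Ω → ℝ}
    (hX : Measurable X) (hE : Measurable E) (hZ : Measurable Z) :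
    Measurable fun p => taylorKernel (X p) (E p) (Z p) := by
  unfold taylorKernel
  exact Measurable.ite (measurableSet_lt hX hZ) ((hE.sub hZ).max measurable_const)
    (Measurable.ite (measurableSet_lt hZ hX) ((hZ.sub hE).max measurable_const) measurable_const)

theorem integral_mul_greenKernel {f : ℝ → ℝ} (hf : ContDiff ℝ (⊤ : ℕ∞) f)
    (hc : HasCompactSupport f) (u : ℝ) :
    ∫ z, deriv (deriv f) z * greenKernel u z = f 0 - f u := by
  have hf' : ContDiff ℝ 1 (deriv f) := (contDiff_infty_iff_deriv.1 hf).2.of_le (by simp)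
  have hi := (hf'.continuous_deriv le_rfl).integrable_of_hasCompactSupport (μ := volume)
    hc.deriv.deriv
  have hlt := integrable_deriv_mul_ite_lt hf' hc.deriv 0
  have hT : Integrable (fun z => deriv (deriv f) z * taylorKernel 0 u z) := by
    refine hi.mul_bdd (c := |u|) (measurable_taylorKernel measurable_const measurable_const
      measurable_id).aestronglyMeasurable (Eventually.of_forall fun z => ?_)
    rw [Real.norm_of_nonneg (taylorKernel_nonneg _ _ _)]
    simpa using taylorKernel_le 0 u z
  have heq : (fun z => deriv (deriv f) z * greenKernel u z) =ᵐ[volume]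
      fun z => -(deriv (deriv f) z * taylorKernel 0 u z) + max (-u) 0 * deriv (deriv f) z
        + u * (deriv (deriv f) z * if 0 < z then 1 else 0) := by
    filter_upwards [(Set.finite_singleton (0 : ℝ)).countable.ae_notMem volume] with z hz
    have : greenKernel u z = max (-u) 0 + u * (if 0 < z then 1 else 0) - taylorKernel 0 u z := by
      simp only [mem_singleton_iff] at hz
      unfold greenKernel taylorKernel
      grind
    rw [this]; ring
  rw [integral_congr_ae heq, integral_add_mul_add_mul hT.fun_neg hi hlt, integral_neg,
    integral_deriv_eq_zero hf' hc.deriv, integral_deriv_mul_ite_lt hf' hc.deriv,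
    integral_mul_taylorKernel hf]
  ring

theorem exists_primitive {g : ℝ → ℝ} (hg : ContDiff ℝ (⊤ : ℕ∞) g) (hc : HasCompactSupport g)
    (h0 : ∫ z, g z = 0) :
    ∃ G : ℝ → ℝ, ContDiff ℝ (⊤ : ℕ∞) G ∧ HasCompactSupport G ∧ deriv G = g := by
  obtain ⟨R, hR⟩ := hc.isCompact.isBounded.subset_closedBall 0
  rw [Real.closedBall_eq_Icc, zero_sub, zero_add] at hR
  have hz : ∀ z, z ∉ Icc (-R) R → g z = 0 := fun z hz =>
    image_eq_zero_of_notMem_tsupport fun h => hz (hR h)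
  have hd : ∀ x, HasDerivAt (fun x => ∫ t in (-R)..x, g t) (g x) x := fun x =>
    (hg.continuous.integral_hasStrictDerivAt _ x).hasDerivAt
  have hdd : deriv (fun x => ∫ t in (-R)..x, g t) = g := funext fun x => (hd x).deriv
  refine ⟨fun x => ∫ t in (-R)..x, g t, ?_, ?_, hdd⟩
  · rw [contDiff_infty_iff_deriv, hdd]
    exact ⟨fun x => (hd x).differentiableAt, hg⟩
  · refine HasCompactSupport.intro (isCompact_Icc (a := -R) (b := max R (-R))) fun x hx => ?_
    rw [mem_Icc, not_and_or, not_le, not_le, max_lt_iff] at hx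
    rcases hx with hx | hx
    · refine (intervalIntegral.integral_congr (g := fun _ => 0) fun t ht => ?_).trans (by simp)
      rcases eq_or_lt_of_le (show t ≤ -R by
        rw [uIcc_of_ge hx.le] at ht; exact ht.2) with h | h
      · have : g =ᶠ[nhdsWithin (-R) (Iio (-R))] fun _ => 0 := by
          filter_upwards [self_mem_nhdsWithin] with s hs
          exact hz s fun h => absurd h.1 (not_le.2 hs)
        have h2 := (hg.continuous.continuousWithinAt (s := Iio (-R)) (x := -R)).tendsto
        rw [h]
        exact tendsto_nhds_unique h2 (tendsto_const_nhds.congr' this.symm)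
      · exact hz t fun h' => absurd h'.1 (not_le.2 h)
    · rw [intervalIntegral.integral_of_le hx.2.le, ← h0]
      refine setIntegral_eq_integral_of_ae_compl_eq_zero ?_
      filter_upwards [(Set.finite_singleton (-R)).countable.ae_notMem volume] with t ht ht'
      refine hz t fun h => ht' ⟨lt_of_le_of_ne h.1 fun h => ht (by simp [h]), h.2.trans hx.1.le⟩

/-- A distribution whose second derivative vanishes is affine. -/
theorem exists_affine_of_integral_deriv_deriv {m : Measure ℝ} [IsLocallyFiniteMeasure m]
    {G : ℝ → ℝ} (hG : LocallyIntegrable G)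
    (h : ∀ f : ℝ → ℝ, ContDiff ℝ (⊤ : ℕ∞) f → HasCompactSupport f →
      ∫ z, deriv (deriv f) z ∂m = ∫ z, deriv (deriv f) z * G z) :
    ∃ α β : ℝ, ∀ φ : ℝ → ℝ, ContDiff ℝ (⊤ : ℕ∞) φ → HasCompactSupport φ →
      ∫ z, φ z ∂m = ∫ z, φ z * (G z + (α + β * z)) := by
  obtain ⟨ρ, hρ, hρc, hρ1⟩ : ∃ ρ : ℝ → ℝ, ContDiff ℝ (⊤ : ℕ∞) ρ ∧ HasCompactSupport ρ ∧
      ∫ z, ρ z = 1 := by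
    let b : ContDiffBump (0 : ℝ) := ⟨1, 2, by norm_num, by norm_num⟩
    exact ⟨b.normed volume, b.contDiff_normed, b.hasCompactSupport_normed, b.integral_normed⟩
  have hρ' : ContDiff ℝ (⊤ : ℕ∞) (deriv ρ) := (contDiff_infty_iff_deriv.1 hρ).2
  have im : ∀ φ : ℝ → ℝ, ContDiff ℝ (⊤ : ℕ∞) φ → HasCompactSupport φ → Integrable φ m :=
    fun φ h1 h2 => h1.continuous.integrable_of_hasCompactSupport h2
  have iG : ∀ φ : ℝ → ℝ, ContDiff ℝ (⊤ : ℕ∞) φ → HasCompactSupport φ →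
      Integrable (fun z => φ z * G z) :=
    fun φ h1 h2 => hG.integrable_smul_left_of_hasCompactSupport h1.continuous h2
  set T : (ℝ → ℝ) → ℝ := fun φ => (∫ z, φ z ∂m) - ∫ z, φ z * G z with hT
  set e : ℝ := ∫ z, z * ρ z with he
  refine ⟨T ρ + T (deriv ρ) * e, -T (deriv ρ), fun φ hφ hφc => ?_⟩
  have iv : ∀ φ : ℝ → ℝ, ContDiff ℝ (⊤ : ℕ∞) φ → HasCompactSupport φ → Integrable φ :=
    fun φ h1 h2 => h1.continuous.integrable_of_hasCompactSupport h2
  have ix : ∀ φ : ℝ → ℝ, ContDiff ℝ (⊤ : ℕ∞) φ → HasCompactSupport φ →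
      Integrable (fun z => z * φ z) :=
    fun φ h1 h2 => (continuous_id.mul h1.continuous).integrable_of_hasCompactSupport h2.mul_left
  set I := ∫ z, φ z with hI
  obtain ⟨Γ, hΓ, hΓc, hΓ'⟩ := exists_primitive (g := fun z => φ z - I * ρ z)
    (hφ.sub (contDiff_const.mul hρ)) (hφc.sub hρc.mul_left) (by
      rw [integral_sub (iv _ hφ hφc) ((iv _ hρ hρc).const_mul _), integral_const_mul, hρ1]; simp [hI])
  set J := ∫ z, Γ z with hJ
  obtain ⟨f, hf, hfc, hf'⟩ := exists_primitive (g := fun z => Γ z - J * ρ z)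
    (hΓ.sub (contDiff_const.mul hρ)) (hΓc.sub hρc.mul_left) (by
      rw [integral_sub (iv _ hΓ hΓc) ((iv _ hρ hρc).const_mul _), integral_const_mul, hρ1]; simp [hJ])
  have hf'' : deriv (deriv f) = fun z => φ z - I * ρ z - J * deriv ρ z := by
    rw [hf']
    ext z
    have d1 : DifferentiableAt ℝ Γ z := hΓ.differentiable (by simp) z
    have d2 : DifferentiableAt ℝ ρ z := hρ.differentiable (by simp) z
    rw [deriv_fun_sub d1 (d2.const_mul _), deriv_const_mul _ d2, hΓ']
  have hJe : J = -(∫ z, z * φ z) + I * e := by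
    have := integral_mul_deriv_eq_deriv_mul_of_integrable (u := fun z => z) (v := Γ)
      (u' := fun _ => 1) (v' := fun z => φ z - I * ρ z) (fun x _ => hasDerivAt_id x)
      (fun x _ => by rw [← congrFun hΓ' x]; exact (hΓ.differentiable (by simp) x).hasDerivAt)
      (ix _ (hφ.sub (contDiff_const.mul hρ)) (hφc.sub hρc.mul_left))
      (by rw [show (fun _ : ℝ => (1 : ℝ)) * Γ = Γ from one_mul Γ]; exact iv _ hΓ hΓc) (ix _ hΓ hΓc)
    simp only [one_mul] at this
    rw [← hJ] at this
    have h2 : ∫ z, z * (φ z - I * ρ z) = (∫ z, z * φ z) - I * e := by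
      rw [he, ← integral_const_mul, ← integral_sub (ix _ hφ hφc) ((ix _ hρ hρc).const_mul _)]
      congr 1; ext z; ring
    linarith
  have hTf := h f hf hfc
  rw [hf''] at hTf
  have e1 : ∫ z, (φ z - I * ρ z - J * deriv ρ z) ∂m
      = (∫ z, φ z ∂m) - I * (∫ z, ρ z ∂m) - J * ∫ z, deriv ρ z ∂m := by
    have := integral_add_mul_add_mul (im _ hφ hφc) (im _ hρ hρc) (im _ hρ' hρc.deriv) (-I) (-J)
    simpa only [neg_mul, ← sub_eq_add_neg] using this
  have e2 : ∫ z, (φ z - I * ρ z - J * deriv ρ z) * G z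
      = (∫ z, φ z * G z) - I * (∫ z, ρ z * G z) - J * ∫ z, deriv ρ z * G z := by
    have := integral_add_mul_add_mul (iG _ hφ hφc) (iG _ hρ hρc) (iG _ hρ' hρc.deriv) (-I) (-J)
    simp only [neg_mul, ← sub_eq_add_neg] at this
    rw [← this]
    congr 1; ext z; ring
  have e3 : ∫ z, φ z * (G z + ((T ρ + T (deriv ρ) * e) + -T (deriv ρ) * z))
      = (∫ z, φ z * G z) + (T ρ + T (deriv ρ) * e) * I + -T (deriv ρ) * ∫ z, z * φ z := by
    rw [hI, ← integral_add_mul_add_mul (iG _ hφ hφc) (iv _ hφ hφc) (ix _ hφ hφc)]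
    congr 1; ext z; ring
  rw [e3]
  simp only [e1, e2] at hTf
  have t1 : T ρ = (∫ z, ρ z ∂m) - ∫ z, ρ z * G z := rfl
  have t2 : T (deriv ρ) = (∫ z, deriv ρ z ∂m) - ∫ z, deriv ρ z * G z := rfl
  have : (∫ z, φ z ∂m) - ∫ z, φ z * G z = I * T ρ + J * T (deriv ρ) := by
    rw [t1, t2]; linarith
  rw [hJe] at this
  linarith

theorem ext_of_integral_contDiff {m₁ m₂ : Measure ℝ} [IsLocallyFiniteMeasure m₁]
    [IsLocallyFiniteMeasure m₂]
    (h : ∀ φ : ℝ → ℝ, ContDiff ℝ (⊤ : ℕ∞) φ → HasCompactSupport φ →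
      ∫ z, φ z ∂m₁ = ∫ z, φ z ∂m₂) : m₁ = m₂ := by
  refine Real.measure_ext_Ioo_rat fun a b => ?_
  set φ : ℕ → ℝ → ℝ := fun n z =>
    Real.smoothTransition (n * (z - a)) * Real.smoothTransition (n * (b - z)) with hφ
  have hsm : ∀ n, ContDiff ℝ (⊤ : ℕ∞) (φ n) := fun n =>
    (Real.smoothTransition.contDiff.comp (by fun_prop)).mul
      (Real.smoothTransition.contDiff.comp (by fun_prop))
  have hzero : ∀ n z, z ∉ Ioo (a : ℝ) b → φ n z = 0 := by
    intro n z hz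
    simp only [mem_Ioo, not_and_or, not_lt] at hz
    rcases hz with hz | hz
    · simp only [hφ]
      rw [Real.smoothTransition.zero_of_nonpos, zero_mul]
      exact mul_nonpos_of_nonneg_of_nonpos n.cast_nonneg (by linarith)
    · simp only [hφ]
      rw [Real.smoothTransition.zero_of_nonpos (x := n * (b - z)), mul_zero]
      exact mul_nonpos_of_nonneg_of_nonpos n.cast_nonneg (by linarith)
  have hcs : ∀ n, HasCompactSupport (φ n) := fun n =>
    HasCompactSupport.intro (isCompact_Icc (a := (a : ℝ)) (b := b)) fun z hz =>
      hzero n z fun h => hz (Ioo_subset_Icc_self h)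
  have hlim : ∀ m : Measure ℝ, IsLocallyFiniteMeasure m →
      Tendsto (fun n => ∫ z, φ n z ∂m) atTop (nhds (m.real (Ioo (a : ℝ) b))) := by
    intro m _
    have : m.real (Ioo (a : ℝ) b) = ∫ z, (Ioo (a : ℝ) b).indicator (fun _ => (1 : ℝ)) z ∂m := by
      rw [integral_indicator measurableSet_Ioo]; simp
    rw [this]
    refine tendsto_integral_of_dominated_convergence ((Ioo (a : ℝ) b).indicator (fun _ => (1 : ℝ)))
      (fun n => (hsm n).continuous.aestronglyMeasurable) ?_ ?_ ?_
    · rw [integrable_indicator_iff measurableSet_Ioo]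
      exact integrableOn_const (measure_Ioo_lt_top.ne)
    · intro n
      refine Eventually.of_forall fun z => ?_
      by_cases hz : z ∈ Ioo (a : ℝ) b
      · rw [indicator_of_mem hz, Real.norm_of_nonneg
          (mul_nonneg (Real.smoothTransition.nonneg _) (Real.smoothTransition.nonneg _))]
        exact mul_le_one₀ (Real.smoothTransition.le_one _) (Real.smoothTransition.nonneg _)
          (Real.smoothTransition.le_one _)
      · rw [hzero n z hz, indicator_of_notMem hz]; simp
    · refine Eventually.of_forall fun z => ?_
      by_cases hz : z ∈ Ioo (a : ℝ) b
      · rw [indicator_of_mem hz]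
        refine tendsto_const_nhds.congr' ?_
        have t1 : Tendsto (fun n : ℕ => (n : ℝ) * (z - a)) atTop atTop :=
          tendsto_natCast_atTop_atTop.atTop_mul_const (sub_pos.2 hz.1)
        have t2 : Tendsto (fun n : ℕ => (n : ℝ) * (b - z)) atTop atTop :=
          tendsto_natCast_atTop_atTop.atTop_mul_const (sub_pos.2 hz.2)
        filter_upwards [t1.eventually_ge_atTop 1, t2.eventually_ge_atTop 1] with n h1 h2
        simp only [hφ]
        rw [Real.smoothTransition.one_of_one_le h1, Real.smoothTransition.one_of_one_le h2, mul_one]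
      · rw [indicator_of_notMem hz]
        simp only [hzero _ z hz]
        exact tendsto_const_nhds
  have := tendsto_nhds_unique (hlim m₁ inferInstance)
    ((hlim m₂ inferInstance).congr fun n => (h _ (hsm n) (hcs n)).symm)
  exact (measureReal_eq_measureReal_iff measure_Ioo_lt_top.ne measure_Ioo_lt_top.ne).1 this

theorem isLocallyFiniteMeasure_withDensity_ofReal {g : ℝ → ℝ} (hg : LocallyIntegrable g) :
    IsLocallyFiniteMeasure (volume.withDensity fun z => ENNReal.ofReal (g z)) := by
  refine ⟨fun x => ?_⟩
  obtain ⟨U, hU, hi⟩ := hg x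
  obtain ⟨V, hVU, hV, hxV⟩ := mem_nhds_iff.1 hU
  refine ⟨V, hV.mem_nhds hxV, ?_⟩
  rw [withDensity_apply _ hV.measurableSet]
  refine lt_of_le_of_lt (lintegral_mono fun z => ?_) (hi.mono_set hVU).2
  exact Real.ofReal_le_enorm _

theorem eq_withDensity_of_integral {m : Measure ℝ} [IsLocallyFiniteMeasure m] {g : ℝ → ℝ}
    (hg : LocallyIntegrable g)
    (h : ∀ φ : ℝ → ℝ, ContDiff ℝ (⊤ : ℕ∞) φ → HasCompactSupport φ →
      ∫ z, φ z ∂m = ∫ z, φ z * g z) :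
    m = volume.withDensity (fun z => ENNReal.ofReal (g z)) := by
  have hpos := isLocallyFiniteMeasure_withDensity_ofReal hg
  have hneg := isLocallyFiniteMeasure_withDensity_ofReal hg.neg
  simp only [Pi.neg_apply] at hneg
  have hm : AEMeasurable g := hg.aestronglyMeasurable.aemeasurable
  have hmn : AEMeasurable fun z => -g z := hm.neg
  have hwd : ∀ k : ℝ → ℝ, AEMeasurable k → ∀ φ : ℝ → ℝ,
      ∫ z, φ z ∂(volume.withDensity fun z => ENNReal.ofReal (k z)) = ∫ z, φ z * max (k z) 0 := by
    intro k hk φ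
    rw [integral_withDensity_eq_integral_toReal_smul₀ hk.ennreal_ofReal (by simp)]
    congr 1; ext z
    rw [ENNReal.toReal_ofReal', smul_eq_mul, mul_comm]
  have hln : LocallyIntegrable fun z => max (-g z) 0 := by
    intro x; exact (hg x).imp fun U hU => ⟨hU.1, hU.2.neg_part⟩
  have key : m + volume.withDensity (fun z => ENNReal.ofReal (-g z))
      = volume.withDensity (fun z => ENNReal.ofReal (g z)) := by
    have : IsLocallyFiniteMeasure (m + volume.withDensity (fun z => ENNReal.ofReal (-g z))) := by
      refine ⟨fun x => ?_⟩
      obtain ⟨U, hU, hU'⟩ := m.finiteAt_nhds x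
      obtain ⟨V, hV, hV'⟩ := (volume.withDensity (fun z => ENNReal.ofReal (-g z))).finiteAt_nhds x
      refine ⟨U ∩ V, inter_mem hU hV, ?_⟩
      rw [Measure.add_apply]
      exact ENNReal.add_lt_top.2 ⟨(measure_mono inter_subset_left).trans_lt hU',
        (measure_mono inter_subset_right).trans_lt hV'⟩
    refine ext_of_integral_contDiff fun φ hφ hφc => ?_
    rw [integral_add_measure (hφ.continuous.integrable_of_hasCompactSupport hφc)
      (hφ.continuous.integrable_of_hasCompactSupport hφc), hwd _ hm, hwd _ hmn, h φ hφ hφc]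
    have i1 : Integrable fun z => φ z * g z :=
      hg.integrable_smul_left_of_hasCompactSupport hφ.continuous hφc
    have i2 : Integrable fun z => φ z * max (-g z) 0 :=
      hln.integrable_smul_left_of_hasCompactSupport hφ.continuous hφc
    rw [← integral_add i1 i2]
    congr 1; ext z
    rw [← mul_add]
    congr 1
    rcases le_total (g z) 0 with h | h
    · rw [max_eq_left (by linarith), max_eq_right h]; ring
    · rw [max_eq_right (by linarith), max_eq_left h]; ring
  have hns : NullMeasurableSet {z | g z < 0} := nullMeasurableSet_lt hm aemeasurable_const
  have hz : (volume.withDensity fun z => ENNReal.ofReal (-g z)) = 0 := by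
    have h1 : (volume.withDensity fun z => ENNReal.ofReal (g z)) {z | g z < 0} = 0 := by
      rw [withDensity_apply₀ _ hns, lintegral_eq_zero_iff' hm.ennreal_ofReal.restrict,
        EventuallyEq, ae_restrict_iff'₀ hns]
      refine Eventually.of_forall fun z hz => ?_
      simpa using (show g z < 0 from hz).le
    have h2 : (volume.withDensity fun z => ENNReal.ofReal (-g z)) {z | g z < 0} = 0 := by
      rw [← key, Measure.add_apply] at h1
      exact (add_eq_zero.1 h1).2
    rw [withDensity_apply₀ _ hns, lintegral_eq_zero_iff' hmn.ennreal_ofReal.restrict,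
        EventuallyEq, ae_restrict_iff'₀ hns] at h2
    rw [withDensity_eq_zero_iff hmn.ennreal_ofReal]
    filter_upwards [h2] with z hz
    by_cases h : g z < 0
    · exact hz h
    · simpa using h
  rw [← key, hz, add_zero]

/-- Fubini for a kernel that is integrable on strips, tested against a compactly supported
function. -/
theorem fubini_strip {Ω : Type*} [MeasurableSpace Ω] {P : Measure Ω} [SFinite P]
    {K : Ω → ℝ → ℝ} (hK : ∀ R : ℝ, Integrable (Function.uncurry K)
      (P.prod (volume.restrict (Icc (-R) R))))
    {φ : ℝ → ℝ} (hφ : Continuous φ) (hφc : HasCompactSupport φ) :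
    Integrable (fun p => ∫ z, φ z * K p z) P ∧
      ∫ p, (∫ z, φ z * K p z) ∂P = ∫ z, φ z * ∫ p, K p z ∂P := by
  obtain ⟨R, hR⟩ := hφc.isCompact.isBounded.subset_closedBall 0
  rw [Real.closedBall_eq_Icc, zero_sub, zero_add] at hR
  obtain ⟨C, hC⟩ := hφc.exists_bound_of_continuous hφ
  have hi : Integrable (fun w : Ω × ℝ => φ w.2 * K w.1 w.2) (P.prod volume) := by
    have h1 := hK R
    rw [← Measure.restrict_univ (μ := P), Measure.prod_restrict] at h1
    rw [← integrableOn_iff_integrable_of_support_subset (s := univ ×ˢ Icc (-R) R)]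
    · exact Integrable.bdd_mul (c := C) h1
        (hφ.measurable.comp measurable_snd).aestronglyMeasurable
        (Eventually.of_forall fun w => hC w.2)
    · intro w hw
      refine ⟨mem_univ _, hR (subset_tsupport _ fun h => hw ?_)⟩
      simp [h]
  refine ⟨hi.integral_prod_left, ?_⟩
  rw [integral_integral_swap hi]
  congr 1; ext z
  rw [integral_const_mul]

theorem locallyIntegrable_strip {Ω : Type*} [MeasurableSpace Ω] {P : Measure Ω} [SFinite P]
    {K : Ω → ℝ → ℝ} (hK : ∀ R : ℝ, Integrable (Function.uncurry K)
      (P.prod (volume.restrict (Icc (-R) R)))) :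
    LocallyIntegrable fun z => ∫ p, K p z ∂P := by
  intro x
  refine ⟨Icc (-(|x| + 1)) (|x| + 1), Icc_mem_nhds ?_ ?_, (hK (|x| + 1)).integral_prod_right⟩
  · linarith [neg_abs_le x]
  · linarith [le_abs_self x]

theorem greenKernel_nonneg (u z : ℝ) : 0 ≤ greenKernel u z := by
  unfold greenKernel; positivity

theorem greenKernel_le (u z : ℝ) : greenKernel u z ≤ |z| := by
  unfold greenKernel
  have h1 := min_le_right (max u 0) (max z 0)
  have h2 := min_le_right (max (-u) 0) (max (-z) 0)
  have h3 : max z 0 + max (-z) 0 = |z| := by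
    rcases le_total z 0 with h | h
    · rw [max_eq_right h, max_eq_left (by linarith), abs_of_nonpos h]; ring
    · rw [max_eq_left h, max_eq_right (by linarith), abs_of_nonneg h]; ring
  linarith

theorem continuous_greenKernel (u : ℝ) : Continuous (greenKernel u) := by
  unfold greenKernel; fun_prop

theorem measurable_greenKernel {Ω : Type*} [MeasurableSpace Ω] {U Z : Ω → ℝ}
    (hU : Measurable U) (hZ : Measurable Z) : Measurable fun p => greenKernel (U p) (Z p) := by
  unfold greenKernel; fun_prop

theorem abs_stepKernel_le_one (x z : ℝ) : |stepKernel x z| ≤ 1 := by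
  unfold stepKernel; split_ifs <;> simp

theorem abs_mul_stepKernel_le (x z : ℝ) : |x * stepKernel x z| ≤ |z| := by
  unfold stepKernel
  split_ifs with h1 h2 h2
  · simp
  · rw [sub_zero, mul_one]
    exact abs_le_abs h1 (by linarith)
  · rw [zero_sub, mul_neg, mul_one, abs_neg, abs_of_nonpos h2, abs_of_nonpos (by linarith)]
    linarith
  · simp

theorem measurable_stepKernel {Ω : Type*} [MeasurableSpace Ω] {X Z : Ω → ℝ}
    (hX : Measurable X) (hZ : Measurable Z) : Measurable fun p => stepKernel (X p) (Z p) := by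
  unfold stepKernel
  exact (Measurable.ite (measurableSet_le hX hZ) measurable_const measurable_const).sub
    (Measurable.ite (measurableSet_le hX measurable_const) measurable_const measurable_const)

theorem continuousAt_stepKernel {x z : ℝ} (h : x ≠ z) : ContinuousAt (stepKernel x) z := by
  unfold stepKernel
  refine ContinuousAt.sub ?_ continuousAt_const
  rcases lt_or_gt_of_ne h with h | h
  · refine (continuousAt_const (y := (1 : ℝ))).congr ?_
    filter_upwards [lt_mem_nhds h] with w hw
    rw [if_pos hw.le]
  · refine (continuousAt_const (y := (0 : ℝ))).congr ?_
    filter_upwards [gt_mem_nhds h] with w hw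
    rw [if_neg (not_le.2 hw)]

theorem continuousAt_taylorKernel {x z : ℝ} (e : ℝ) (h : x ≠ z) :
    ContinuousAt (taylorKernel x e) z := by
  rcases lt_or_gt_of_ne h with h | h
  · refine (show Continuous fun w : ℝ => max (e - w) 0 by fun_prop).continuousAt.congr ?_
    filter_upwards [lt_mem_nhds h] with w hw
    simp only [taylorKernel, if_pos hw]
  · refine (show Continuous fun w : ℝ => max (w - e) 0 by fun_prop).continuousAt.congr ?_
    filter_upwards [gt_mem_nhds h] with w hw
    simp only [taylorKernel, if_pos hw, if_neg (not_lt.2 (le_of_lt hw))]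

theorem abs_sub_le_of_taylorKernel_pos {x e z : ℝ} (h : 0 < taylorKernel x e z) :
    |x - z| ≤ |e - x| := by
  unfold taylorKernel at h
  split_ifs at h with h1 h2
  · have : 0 < e - z := by simpa using h
    rw [abs_of_nonpos (by linarith), abs_of_nonneg (by linarith)]; linarith
  · have : 0 < z - e := by simpa using h
    rw [abs_of_nonneg (by linarith), abs_of_nonpos (by linarith)]; linarith
  · exact absurd h (lt_irrefl _)

theorem integrable_strip_of_bound {Ω : Type*} [MeasurableSpace Ω] {P : Measure Ω}
    [IsFiniteMeasure P] {K : Ω → ℝ → ℝ} (hK : Measurable (Function.uncurry K)) {B D : ℝ}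
    (hB : ∀ p z, |K p z| ≤ B + D * |z|) (R : ℝ) :
    Integrable (Function.uncurry K) (P.prod (volume.restrict (Icc (-R) R))) := by
  have hb : Integrable (fun w : Ω × ℝ => B + D * |w.2|)
      (P.prod (volume.restrict (Icc (-R) R))) := by
    have h1 : Integrable (fun z : ℝ => B + D * |z|) (volume.restrict (Icc (-R) R)) :=
      (show Continuous fun z : ℝ => B + D * |z| by fun_prop).integrableOn_Icc
    exact h1.comp_snd P
  exact hb.mono' hK.aestronglyMeasurable (Eventually.of_forall fun w => hB w.1 w.2)

theorem continuousAt_integral_of_bound {Ω : Type*} [MeasurableSpace Ω] {P : Measure Ω}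
    [IsFiniteMeasure P] {K : Ω → ℝ → ℝ} (hK : ∀ z, Measurable fun p => K p z) {B D : ℝ}
    (hD : 0 ≤ D) (hB : ∀ z, ∀ᵐ p ∂P, |K p z| ≤ B + D * |z|) {z₀ : ℝ}
    (hc : ∀ᵐ p ∂P, ContinuousAt (K p) z₀) : ContinuousAt (fun z => ∫ p, K p z ∂P) z₀ := by
  refine continuousAt_of_dominated (F := fun z p => K p z)
    (bound := fun _ => B + D * (|z₀| + 1))
    (Eventually.of_forall fun z => (hK z).aestronglyMeasurable) ?_ (integrable_const _) hc
  have : ∀ᶠ z in nhds z₀, |z| < |z₀| + 1 :=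
    continuous_abs.continuousAt.eventually (gt_mem_nhds (by linarith))
  filter_upwards [this] with z hz
  filter_upwards [hB z] with p hp
  exact hp.trans (by gcongr)

theorem IsLevyMeasure.sFinite {ν : Measure ℝ} (hν : IsLevyMeasure ν) : SFinite ν := by
  have hm : Measurable fun y : ℝ => ENNReal.ofReal (min 1 (y ^ 2)) := by fun_prop
  have : IsFiniteMeasure (ν.withDensity fun y => ENNReal.ofReal (min 1 (y ^ 2))) :=
    isFiniteMeasure_withDensity hν.2.ne
  rw [← withDensity_inv_same hm (μ := ν) ?_ (by simp)]
  · infer_instance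
  · have h0 : ∀ᵐ y ∂ν, y ≠ 0 := by simpa [ae_iff] using hν.1
    filter_upwards [h0] with y hy
    have : 0 < min 1 (y ^ 2) := lt_min one_pos (by positivity)
    exact (ENNReal.ofReal_pos.2 this).ne'

theorem IsLevyMeasure.measure_compl_Icc_lt_top {ν : Measure ℝ} (hν : IsLevyMeasure ν) {ε : ℝ}
    (h0 : 0 < ε) (h1 : ε ≤ 1) : ν (Icc (-ε) ε)ᶜ < ⊤ := by
  have hm : Measurable fun y : ℝ => ENNReal.ofReal (min 1 (y ^ 2)) := by fun_prop
  have hne : ENNReal.ofReal (ε ^ 2) ≠ 0 := by simpa using h0.ne'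
  refine lt_of_le_of_lt (b := ν {y | ENNReal.ofReal (ε ^ 2) ≤ ENNReal.ofReal (min 1 (y ^ 2))}) ?_
    ((meas_ge_le_lintegral_div hm.aemeasurable hne ENNReal.ofReal_ne_top).trans_lt
      (ENNReal.div_lt_top hν.2.ne hne))
  refine measure_mono fun y hy => ?_
  have : ε < |y| := by
    rw [← not_le, abs_le]; exact hy
  refine ENNReal.ofReal_le_ofReal (le_min (by nlinarith) ?_)
  rw [← sq_abs y]; nlinarith

theorem IsLevyMeasure.tendsto_lintegral_sq {ν : Measure ℝ} (hν : IsLevyMeasure ν) :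
    Tendsto (fun ε : ℝ => ∫⁻ y in Icc (-ε) ε, ENNReal.ofReal (y ^ 2) ∂ν)
      (nhdsWithin 0 (Ioi 0)) (nhds 0) := by
  have hfin : IsFiniteMeasure (ν.withDensity fun y => ENNReal.ofReal (min 1 (y ^ 2))) :=
    isFiniteMeasure_withDensity hν.2.ne
  have h := tendsto_measure_biInter_gt
    (μ := ν.withDensity fun y => ENNReal.ofReal (min 1 (y ^ 2)))
    (s := fun ε : ℝ => Icc (-ε) ε) (a := 0) (fun r _ => measurableSet_Icc.nullMeasurableSet)
    (fun i j _ hij => Icc_subset_Icc (by linarith) hij) ⟨1, one_pos, measure_ne_top _ _⟩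
  have hI : ⋂ r : ℝ, ⋂ _ : r > 0, Icc (-r) r = {0} := by
    ext y
    simp only [mem_iInter, mem_singleton_iff]
    refine ⟨fun hy => ?_, fun hy r hr => by simp [hy, hr.le]⟩
    by_contra hne
    have := abs_le.2 (hy (|y| / 2) (by positivity))
    have : 0 < |y| := abs_pos.2 hne
    linarith
  rw [hI, withDensity_apply _ (measurableSet_singleton 0), Measure.restrict_eq_zero.2 hν.1,
    lintegral_zero_measure] at h
  refine h.congr' ?_
  filter_upwards [Ioc_mem_nhdsGT (show (0 : ℝ) < 1 by norm_num)] with ε hε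
  simp only [Function.comp]
  rw [withDensity_apply _ measurableSet_Icc]
  refine setLIntegral_congr_fun measurableSet_Icc fun y hy => ?_
  have : |y| ≤ ε := abs_le.2 hy
  rw [min_eq_right]
  rw [← sq_abs]; nlinarith [abs_nonneg y, hε.2]

/-- The state-dependent jump sizes `c x * y` for which the Taylor kernels of small jumps stay
controlled by the target point. -/
structure JumpCoeff (c : ℝ → ℝ) : Prop where
  measurable : Measurable c
  taylorKernel_le : ∀ x y z, |y| ≤ 1 → taylorKernel x (x + c x * y) z ≤ 1 + |z|
  abs_mul_le : ∀ x y z, |y| ≤ 1 / 2 → 0 < taylorKernel x (x + c x * y) z →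
    |c x * y| ≤ 2 * (1 + |z|) * |y|

theorem jumpCoeff_one : JumpCoeff fun _ => 1 where
  measurable := measurable_const
  taylorKernel_le x y z hy := by
    have := KEF.taylorKernel_le x (x + 1 * y) z
    rw [add_sub_cancel_left, one_mul] at this
    rw [one_mul]
    linarith [abs_nonneg z]
  abs_mul_le x y z _ _ := by
    rw [one_mul]
    nlinarith [abs_nonneg z, abs_nonneg y, mul_nonneg (abs_nonneg z) (abs_nonneg y)]

theorem jumpCoeff_id : JumpCoeff fun x => x where
  measurable := measurable_id
  taylorKernel_le x y z hy := by
    have hy' := abs_le.1 hy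
    unfold taylorKernel
    split_ifs with h1 h2
    · refine max_le ?_ (by positivity)
      rcases le_total 0 x with hx | hx
      · rw [abs_of_pos (by linarith)]; nlinarith
      · have := neg_abs_le z; nlinarith
    · refine max_le ?_ (by positivity)
      rcases le_total 0 x with hx | hx
      · have := le_abs_self z; nlinarith
      · rw [abs_of_neg (by linarith)]; nlinarith
    · positivity
  abs_mul_le x y z hy h := by
    have hy' := abs_le.1 hy
    rw [abs_mul]
    refine mul_le_mul_of_nonneg_right ?_ (abs_nonneg _)
    unfold taylorKernel at h
    split_ifs at h with h1 h2
    · have h3 : 0 < x + x * y - z := by simpa using h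
      rcases le_total 0 x with hx | hx
      · rw [abs_of_nonneg hx, abs_of_pos (by linarith)]; linarith
      · rw [abs_of_nonpos hx]; have := neg_abs_le z; nlinarith
    · have h3 : 0 < z - (x + x * y) := by simpa using h
      rcases le_total 0 x with hx | hx
      · rw [abs_of_nonneg hx]; have := le_abs_self z; nlinarith
      · rw [abs_of_nonpos hx, abs_of_neg (by linarith)]; linarith
    · exact absurd h (lt_irrefl _)

/-- The kernel representing one jump of the generator through `f''`. -/
def jumpKernel (c : ℝ → ℝ) (p : ℝ × ℝ) (z : ℝ) : ℝ :=
  if |p.2| ≤ 1 then taylorKernel p.1 (p.1 + c p.1 * p.2) z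
  else greenKernel p.1 z - greenKernel (p.1 + c p.1 * p.2) z

theorem integral_mul_jumpKernel (c : ℝ → ℝ) {f : ℝ → ℝ} (hf : ContDiff ℝ (⊤ : ℕ∞) f)
    (hc : HasCompactSupport f) (p : ℝ × ℝ) :
    ∫ z, deriv (deriv f) z * jumpKernel c p z
      = f (p.1 + c p.1 * p.2) - f p.1 - if |p.2| ≤ 1 then c p.1 * p.2 * deriv f p.1 else 0 := by
  have hf' : ContDiff ℝ 1 (deriv f) := (contDiff_infty_iff_deriv.1 hf).2.of_le (by simp)
  unfold jumpKernel
  split_ifs with h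
  · rw [integral_mul_taylorKernel hf, add_sub_cancel_left]
  · have hi : ∀ u, Integrable fun z => deriv (deriv f) z * greenKernel u z := fun u =>
      ((hf'.continuous_deriv le_rfl).mul (continuous_greenKernel u)).integrable_of_hasCompactSupport
        hc.deriv.deriv.mul_right
    simp only [mul_sub]
    rw [integral_sub (hi _) (hi _), integral_mul_greenKernel hf hc, integral_mul_greenKernel hf hc]
    ring

section Jump

variable {c : ℝ → ℝ}

theorem JumpCoeff.measurable_uncurry (hc : JumpCoeff c) :
    Measurable (Function.uncurry (jumpKernel c)) := by
  have hm := hc.measurable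
  have he : Measurable fun w : (ℝ × ℝ) × ℝ => w.1.1 + c w.1.1 * w.1.2 := by fun_prop
  exact Measurable.ite (measurableSet_le (by fun_prop) measurable_const)
    (measurable_taylorKernel (by fun_prop) he measurable_snd)
    ((measurable_greenKernel (by fun_prop) measurable_snd).sub
      (measurable_greenKernel he measurable_snd))

theorem JumpCoeff.measurable_jumpKernel (hc : JumpCoeff c) (z : ℝ) :
    Measurable fun p => jumpKernel c p z :=
  hc.measurable_uncurry.comp (measurable_id.prodMk measurable_const)

theorem abs_jumpKernel_le_abs {p : ℝ × ℝ} (h : 1 < |p.2|) (z : ℝ) : |jumpKernel c p z| ≤ |z| := by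
  rw [jumpKernel, if_neg (not_le.2 h), abs_le]
  have h1 := greenKernel_nonneg p.1 z
  have h2 := greenKernel_le p.1 z
  have h3 := greenKernel_nonneg (p.1 + c p.1 * p.2) z
  have h4 := greenKernel_le (p.1 + c p.1 * p.2) z
  constructor <;> linarith

theorem JumpCoeff.abs_jumpKernel_le (hc : JumpCoeff c) (p : ℝ × ℝ) (z : ℝ) :
    |jumpKernel c p z| ≤ 1 + 1 * |z| := by
  rcases le_or_gt (|p.2|) 1 with h | h
  · rw [jumpKernel, if_pos h, abs_of_nonneg (taylorKernel_nonneg _ _ _), one_mul]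
    exact hc.taylorKernel_le _ _ _ h
  · have := abs_jumpKernel_le_abs (c := c) h z
    linarith

theorem JumpCoeff.abs_jumpKernel_le_indicator (hc : JumpCoeff c) {p : ℝ × ℝ} (h : |p.2| ≤ 1 / 2)
    {z r : ℝ} (hr : 1 + |z| ≤ r) :
    |jumpKernel c p z| ≤ {x | |x - z| ≤ 2 * r * |p.2|}.indicator (fun _ => 2 * r * |p.2|) p.1 := by
  have hr0 : 0 ≤ r := by linarith [abs_nonneg z]
  rw [jumpKernel, if_pos (by linarith), abs_of_nonneg (taylorKernel_nonneg _ _ _)]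
  rcases (taylorKernel_nonneg p.1 (p.1 + c p.1 * p.2) z).eq_or_lt with h0 | h0
  · rw [← h0]
    exact indicator_nonneg (fun _ _ => by positivity) _
  · have h1 : |c p.1 * p.2| ≤ 2 * r * |p.2| :=
      (hc.abs_mul_le _ _ _ h h0).trans (by gcongr)
    have h2 := abs_sub_le_of_taylorKernel_pos h0
    have h3 := KEF.taylorKernel_le p.1 (p.1 + c p.1 * p.2) z
    rw [add_sub_cancel_left] at h2 h3
    rw [indicator_of_mem (show p.1 ∈ {x | |x - z| ≤ 2 * r * |p.2|} from h2.trans h1)]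
    exact h3.trans h1

theorem JumpCoeff.lintegral_Icc_jumpKernel_le (hc : JumpCoeff c) {R : ℝ} (hR : 0 ≤ R)
    (p : ℝ × ℝ) :
    ∫⁻ z in Icc (-R) R, ‖jumpKernel c p z‖ₑ
      ≤ ENNReal.ofReal (8 * (1 + R) ^ 2) * ENNReal.ofReal (min 1 (p.2 ^ 2)) := by
  rw [← ENNReal.ofReal_mul (by positivity)]
  have hz : ∀ z ∈ Icc (-R) R, |z| ≤ R := fun z hz => abs_le.2 hz
  rcases le_or_gt (|p.2|) (1 / 2) with h | h
  · set D := 2 * (1 + R) * |p.2| with hD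
    have hD0 : 0 ≤ D := by positivity
    calc ∫⁻ z in Icc (-R) R, ‖jumpKernel c p z‖ₑ
        ≤ ∫⁻ z in Icc (-R) R, (Icc (p.1 - D) (p.1 + D)).indicator
            (fun _ => ENNReal.ofReal D) z := by
          refine setLIntegral_mono' measurableSet_Icc fun z hzR => ?_
          have h1 := hc.abs_jumpKernel_le_indicator h (z := z) (r := 1 + R)
            (by linarith [hz z hzR])
          rw [← ofReal_norm, Real.norm_eq_abs]
          refine (ENNReal.ofReal_le_ofReal h1).trans ?_
          by_cases hm : p.1 ∈ {x | |x - z| ≤ 2 * (1 + R) * |p.2|}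
          · have hm' := abs_le.1 (show |p.1 - z| ≤ D from hm)
            rw [indicator_of_mem hm, indicator_of_mem]
            constructor <;> linarith
          · rw [indicator_of_notMem hm]; simp
      _ ≤ ∫⁻ z, (Icc (p.1 - D) (p.1 + D)).indicator (fun _ => ENNReal.ofReal D) z :=
          setLIntegral_le_lintegral _ _
      _ = ENNReal.ofReal (D * (2 * D)) := by
          rw [lintegral_indicator_const measurableSet_Icc, Real.volume_Icc,
            ← ENNReal.ofReal_mul hD0]
          congr 1; ring
      _ ≤ _ := by
          refine ENNReal.ofReal_le_ofReal ?_
          have h4 : p.2 ^ 2 ≤ 1 := by rw [← sq_abs]; nlinarith [abs_nonneg p.2]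
          rw [min_eq_right h4, ← sq_abs p.2, hD]
          exact le_of_eq (by ring)
  · calc ∫⁻ z in Icc (-R) R, ‖jumpKernel c p z‖ₑ
        ≤ ∫⁻ z in Icc (-R) R, ENNReal.ofReal (1 + R) := by
          refine setLIntegral_mono' measurableSet_Icc fun z hzR => ?_
          rw [← ofReal_norm, Real.norm_eq_abs]
          exact ENNReal.ofReal_le_ofReal
            ((hc.abs_jumpKernel_le p z).trans (by linarith [hz z hzR]))
      _ = ENNReal.ofReal ((1 + R) * (2 * R)) := by
          rw [setLIntegral_const, Real.volume_Icc, ← ENNReal.ofReal_mul (by positivity)]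
          congr 1; ring
      _ ≤ _ := by
          refine ENNReal.ofReal_le_ofReal ?_
          have : 1 / 4 ≤ min 1 (p.2 ^ 2) := by
            refine le_min (by norm_num) ?_
            rw [← sq_abs]; nlinarith
          nlinarith [sq_nonneg (1 + R)]

variable {μ ν : Measure ℝ} [IsProbabilityMeasure μ]

theorem JumpCoeff.integrable_strip (hc : JumpCoeff c) (hν : IsLevyMeasure ν) (R : ℝ) :
    Integrable (Function.uncurry (jumpKernel c))
      ((μ.prod ν).prod (volume.restrict (Icc (-R) R))) := by
  have := hν.sFinite
  rcases lt_or_ge R 0 with hR | hR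
  · rw [Icc_eq_empty (by linarith)]
    simp
  refine ⟨hc.measurable_uncurry.aestronglyMeasurable, ?_⟩
  rw [HasFiniteIntegral, lintegral_prod _ hc.measurable_uncurry.enorm.aemeasurable]
  refine lt_of_le_of_lt (lintegral_mono fun p => hc.lintegral_Icc_jumpKernel_le hR p) ?_
  rw [lintegral_prod _ (by fun_prop)]
  simp only [lintegral_const, measure_univ, mul_one]
  rw [lintegral_const_mul _ (by fun_prop)]
  exact ENNReal.mul_lt_top ENNReal.ofReal_lt_top hν.2

/-- The contribution of the jumps to the density. -/
def jumpPart (c : ℝ → ℝ) (μ ν : Measure ℝ) (z : ℝ) : ℝ := ∫ p, jumpKernel c p z ∂(μ.prod ν)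

theorem JumpCoeff.locallyIntegrable_jumpPart (hc : JumpCoeff c) (hν : IsLevyMeasure ν) :
    LocallyIntegrable (jumpPart c μ ν) := by
  have := hν.sFinite
  exact locallyIntegrable_strip fun R => hc.integrable_strip hν R

theorem JumpCoeff.integral_jump (hc : JumpCoeff c) (hν : IsLevyMeasure ν) {f : ℝ → ℝ}
    (hf : ContDiff ℝ (⊤ : ℕ∞) f) (hfc : HasCompactSupport f) :
    Integrable (fun x => ∫ y, (f (x + c x * y) - f x -
      (if |y| ≤ 1 then c x * y * deriv f x else 0)) ∂ν) μ ∧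
    ∫ x, (∫ y, (f (x + c x * y) - f x -
      (if |y| ≤ 1 then c x * y * deriv f x else 0)) ∂ν) ∂μ
      = ∫ z, deriv (deriv f) z * jumpPart c μ ν z := by
  have := hν.sFinite
  have hf' : ContDiff ℝ 1 (deriv f) := (contDiff_infty_iff_deriv.1 hf).2.of_le (by simp)
  obtain ⟨h1, h2⟩ := fubini_strip (P := μ.prod ν) (fun R => hc.integrable_strip hν R)
    (hf'.continuous_deriv le_rfl) hfc.deriv.deriv
  simp only [integral_mul_jumpKernel c hf hfc] at h1 h2
  rw [integral_prod _ h1] at h2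
  exact ⟨h1.integral_prod_left, h2⟩

theorem neg_jumpPart_le (hν : IsLevyMeasure ν) (z : ℝ) :
    -jumpPart c μ ν z ≤ (ν (Icc (-1) 1)ᶜ).toReal * |z| := by
  have := hν.sFinite
  by_cases hi : Integrable (fun p => jumpKernel c p z) (μ.prod ν)
  · have hs : MeasurableSet ((univ : Set ℝ) ×ˢ (Icc (-1 : ℝ) 1)ᶜ) :=
      MeasurableSet.univ.prod measurableSet_Icc.compl
    have hm : (μ.prod ν) ((univ : Set ℝ) ×ˢ (Icc (-1 : ℝ) 1)ᶜ) = ν (Icc (-1) 1)ᶜ := by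
      rw [Measure.prod_prod, measure_univ, one_mul]
    have hlt := hν.measure_compl_Icc_lt_top one_pos le_rfl
    rw [jumpPart, ← integral_neg]
    calc ∫ p, -jumpKernel c p z ∂(μ.prod ν)
        ≤ ∫ p, ((univ : Set ℝ) ×ˢ (Icc (-1 : ℝ) 1)ᶜ).indicator (fun _ => |z|) p ∂(μ.prod ν) := by
          refine integral_mono hi.neg
            ((integrable_indicator_iff hs).2 (integrableOn_const (by rw [hm]; exact hlt.ne)))
            fun p => ?_
          rcases le_or_gt (|p.2|) 1 with h | h
          · refine le_trans ?_ (indicator_nonneg (fun _ _ => abs_nonneg z) _)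
            rw [jumpKernel, if_pos h, neg_nonpos]
            exact taylorKernel_nonneg _ _ _
          · rw [indicator_of_mem (show p ∈ (univ : Set ℝ) ×ˢ (Icc (-1 : ℝ) 1)ᶜ from
              ⟨mem_univ _, fun h' => not_le.2 h (abs_le.2 h')⟩)]
            exact (neg_le_abs _).trans (abs_jumpKernel_le_abs h z)
      _ = _ := by
          rw [integral_indicator_const _ hs, measureReal_def, hm, smul_eq_mul]
  · rw [jumpPart, integral_undef hi, neg_zero]
    positivity

theorem JumpCoeff.lintegral_jumpKernel_le (hc : JumpCoeff c) (hν : IsLevyMeasure ν) {U : Set ℝ}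
    {C : ENNReal} (hC : ∀ s ⊆ U, MeasurableSet s → μ s ≤ C * volume s) {z r ε : ℝ} (hr : 1 + |z| ≤ r)
    (hε : ε ≤ 1 / 2) (hU : Icc (z - 2 * r * ε) (z + 2 * r * ε) ⊆ U) :
    ∫⁻ p, ‖jumpKernel c p z‖ₑ ∂(μ.prod (ν.restrict (Icc (-ε) ε)))
      ≤ C * ENNReal.ofReal (8 * r ^ 2) * ∫⁻ y in Icc (-ε) ε, ENNReal.ofReal (y ^ 2) ∂ν := by
  have := hν.sFinite
  have hr0 : 0 ≤ r := by linarith [abs_nonneg z]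
  rw [lintegral_prod_symm _ (hc.measurable_jumpKernel z).enorm.aemeasurable,
    ← lintegral_const_mul _ (by fun_prop)]
  refine setLIntegral_mono' measurableSet_Icc fun y hy => ?_
  have hy' : |y| ≤ ε := abs_le.2 hy
  set D := 2 * r * |y| with hD
  have hD0 : 0 ≤ D := by positivity
  have hset : {x : ℝ | |x - z| ≤ D} = Icc (z - D) (z + D) := by
    ext x
    simp only [mem_ofPred_eq, mem_Icc, abs_le]
    constructor <;> rintro ⟨h1, h2⟩ <;> constructor <;> linarith
  calc ∫⁻ x, ‖jumpKernel c (x, y) z‖ₑ ∂μ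
      ≤ ∫⁻ x, (Icc (z - D) (z + D)).indicator (fun _ => ENNReal.ofReal D) x ∂μ := by
        refine lintegral_mono fun x => ?_
        have h1 := hc.abs_jumpKernel_le_indicator (p := (x, y)) (hy'.trans hε) hr
        simp only [← hD, hset] at h1
        rw [← ofReal_norm, Real.norm_eq_abs]
        refine (ENNReal.ofReal_le_ofReal h1).trans ?_
        by_cases hm : x ∈ Icc (z - D) (z + D)
        · rw [indicator_of_mem hm, indicator_of_mem hm]
        · rw [indicator_of_notMem hm]; simp
    _ = ENNReal.ofReal D * μ (Icc (z - D) (z + D)) :=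
        lintegral_indicator_const measurableSet_Icc _
    _ ≤ ENNReal.ofReal D * (C * volume (Icc (z - D) (z + D))) := by
        gcongr
        refine hC _ (Subset.trans (Icc_subset_Icc ?_ ?_) hU) measurableSet_Icc
        · have : D ≤ 2 * r * ε := by rw [hD]; gcongr
          linarith
        · have : D ≤ 2 * r * ε := by rw [hD]; gcongr
          linarith
    _ = C * (ENNReal.ofReal D * ENNReal.ofReal (2 * D)) := by
        rw [Real.volume_Icc, show z + D - (z - D) = 2 * D by ring]; ring
    _ = _ := by
        rw [← ENNReal.ofReal_mul hD0, mul_assoc C, ← ENNReal.ofReal_mul (by positivity), hD,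
          ← sq_abs y]
        congr 2; ring

theorem measure_singleton_eq_zero_of_le {μ : Measure ℝ} {U : Set ℝ} {z₀ : ℝ} (hU : U ∈ nhds z₀)
    {C : ENNReal} (hC : ∀ s ⊆ U, MeasurableSet s → μ s ≤ C * volume s) : μ {z₀} = 0 := by
  have := hC {z₀} (singleton_subset_iff.2 (mem_of_mem_nhds hU)) (measurableSet_singleton _)
  simpa using this

theorem JumpCoeff.continuousAt_jumpPart (hc : JumpCoeff c) (hν : IsLevyMeasure ν) {U : Set ℝ}
    {z₀ : ℝ} (hU : U ∈ nhds z₀) {C : ENNReal} (hCt : C ≠ ⊤)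
    (hC : ∀ s ⊆ U, MeasurableSet s → μ s ≤ C * volume s) : ContinuousAt (jumpPart c μ ν) z₀ := by
  have := hν.sFinite
  obtain ⟨δ, hδ, hδU⟩ := Metric.mem_nhds_iff.1 hU
  have hμ0 := measure_singleton_eq_zero_of_le hU hC
  set r := 2 + |z₀| with hr
  have hr0 : 0 < r := by positivity
  have hlim : Tendsto (fun ε : ℝ => C * ENNReal.ofReal (8 * r ^ 2) *
      ∫⁻ y in Icc (-ε) ε, ENNReal.ofReal (y ^ 2) ∂ν) (nhdsWithin 0 (Ioi 0)) (nhds 0) := by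
    have := ENNReal.Tendsto.const_mul (a := C * ENNReal.ofReal (8 * r ^ 2)) hν.tendsto_lintegral_sq
      (Or.inr (ENNReal.mul_ne_top hCt ENNReal.ofReal_ne_top))
    rwa [mul_zero] at this
  refine continuousAt_of_locally_uniform_approx_of_continuousAt fun u hu => ?_
  obtain ⟨κ, hκ, hκu⟩ := Metric.mem_uniformity_dist.1 hu
  have hev : ∀ᶠ ε : ℝ in nhdsWithin 0 (Ioi 0), (0 < ε ∧ ε < min (1 / 2) (δ / (4 * r))) ∧
      C * ENNReal.ofReal (8 * r ^ 2) * ∫⁻ y in Icc (-ε) ε, ENNReal.ofReal (y ^ 2) ∂ν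
        < ENNReal.ofReal κ :=
    Filter.Eventually.and
      (Ioo_mem_nhdsGT (show (0 : ℝ) < min (1 / 2) (δ / (4 * r)) by positivity))
      (hlim.eventually (gt_mem_nhds (ENNReal.ofReal_pos.2 hκ)))
  obtain ⟨ε, ⟨hε0, hε⟩, hεκ⟩ := hev.exists
  have hε1 : ε ≤ 1 / 2 := (hε.trans_le (min_le_left _ _)).le
  have hε2 : 2 * r * ε < δ / 2 := by
    have := hε.trans_le (min_le_right _ _)
    rw [lt_div_iff₀ (by positivity)] at this
    linarith
  have hfin : IsFiniteMeasure (ν.restrict (Icc (-ε) ε)ᶜ) :=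
    isFiniteMeasure_restrict.2 (hν.measure_compl_Icc_lt_top hε0 (by linarith)).ne
  refine ⟨Metric.ball z₀ (min 1 (δ / 2)), Metric.ball_mem_nhds _ (by positivity),
    jumpPart c μ (ν.restrict (Icc (-ε) ε)ᶜ), ?_, fun z hz => hκu ?_⟩
  · refine continuousAt_integral_of_bound (fun z => hc.measurable_jumpKernel z) zero_le_one
      (fun z => Eventually.of_forall fun p => hc.abs_jumpKernel_le p z) ?_
    have h1 : ∀ᵐ x ∂μ, x ≠ z₀ := by simpa [ae_iff] using hμ0
    have h2 : ∀ᵐ p ∂(μ.prod (ν.restrict (Icc (-ε) ε)ᶜ)), p.1 ≠ z₀ :=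
      Measure.quasiMeasurePreserving_fst.ae h1
    filter_upwards [h2] with p hp
    unfold jumpKernel
    split_ifs
    · exact continuousAt_taylorKernel _ hp
    · exact ((continuous_greenKernel _).sub (continuous_greenKernel _)).continuousAt
  · have hz' : |z - z₀| < min 1 (δ / 2) := by simpa [Real.dist_eq] using hz
    have hz1 := abs_lt.1 (hz'.trans_le (min_le_right _ _))
    have hzr : 1 + |z| ≤ r := by
      have h1 := hz'.trans_le (min_le_left _ _)
      have h2 := abs_add_le (z - z₀) z₀
      rw [sub_add_cancel] at h2
      linarith
    have hle := hc.lintegral_jumpKernel_le hν hC hzr hε1 (Subset.trans (fun w hw => by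
      rw [Metric.mem_ball, Real.dist_eq, abs_lt]
      constructor <;> linarith [hw.1, hw.2]) hδU)
    have hlt := hle.trans_lt hεκ
    have hi1 : Integrable (fun p => jumpKernel c p z) (μ.prod (ν.restrict (Icc (-ε) ε))) :=
      ⟨(hc.measurable_jumpKernel z).aestronglyMeasurable, hlt.trans ENNReal.ofReal_lt_top⟩
    have hi2 : Integrable (fun p => jumpKernel c p z) (μ.prod (ν.restrict (Icc (-ε) ε)ᶜ)) :=
      (integrable_const (1 + 1 * |z|)).mono' (hc.measurable_jumpKernel z).aestronglyMeasurable
        (Eventually.of_forall fun p => hc.abs_jumpKernel_le p z)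
    have hsplit : jumpPart c μ ν z = (∫ p, jumpKernel c p z ∂(μ.prod (ν.restrict (Icc (-ε) ε))))
        + jumpPart c μ (ν.restrict (Icc (-ε) ε)ᶜ) z := by
      rw [jumpPart, jumpPart, ← integral_add_measure hi1 hi2, ← Measure.prod_add,
        Measure.restrict_add_restrict_compl measurableSet_Icc]
    rw [hsplit, Real.dist_eq, add_sub_cancel_right, ← Real.norm_eq_abs]
    refine (norm_integral_le_lintegral_norm _).trans_lt ?_
    simp only [ofReal_norm]
    rw [← ENNReal.toReal_ofReal hκ.le]
    exact ENNReal.toReal_strict_mono ENNReal.ofReal_ne_top hlt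

end Jump

/-- The contribution of the drift to the density. -/
def driftPart (γ δ : ℝ) (μ : Measure ℝ) (z : ℝ) : ℝ := ∫ x, (γ + δ * x) * stepKernel x z ∂μ

theorem abs_drift_mul_stepKernel_le (γ δ x z : ℝ) :
    |(γ + δ * x) * stepKernel x z| ≤ |γ| + |δ| * |z| := by
  have h1 := abs_stepKernel_le_one x z
  have h2 := abs_mul_stepKernel_le x z
  calc |(γ + δ * x) * stepKernel x z| = |γ * stepKernel x z + δ * (x * stepKernel x z)| := by
        congr 1; ring
    _ ≤ |γ * stepKernel x z| + |δ * (x * stepKernel x z)| := abs_add_le _ _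
    _ = |γ| * |stepKernel x z| + |δ| * |x * stepKernel x z| := by rw [abs_mul γ, abs_mul δ]
    _ ≤ |γ| * 1 + |δ| * |z| := by gcongr
    _ = _ := by rw [mul_one]

section Drift

variable {μ : Measure ℝ} [IsProbabilityMeasure μ]

theorem integrable_strip_drift (γ δ R : ℝ) :
    Integrable (Function.uncurry fun x z => (γ + δ * x) * stepKernel x z)
      (μ.prod (volume.restrict (Icc (-R) R))) := by
  refine integrable_strip_of_bound ?_ (fun x z => abs_drift_mul_stepKernel_le γ δ x z) R
  exact Measurable.mul (by fun_prop) (measurable_stepKernel measurable_fst measurable_snd)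

theorem locallyIntegrable_driftPart (γ δ : ℝ) : LocallyIntegrable (driftPart γ δ μ) :=
  locallyIntegrable_strip fun R => integrable_strip_drift γ δ R

theorem integral_drift (γ δ : ℝ) {f : ℝ → ℝ}
    (hf : ContDiff ℝ (⊤ : ℕ∞) f) (hfc : HasCompactSupport f) :
    ∫ x, (γ + δ * x) * deriv f x ∂μ = -∫ z, deriv (deriv f) z * driftPart γ δ μ z := by
  have hf' : ContDiff ℝ 1 (deriv f) := (contDiff_infty_iff_deriv.1 hf).2.of_le (by simp)
  have h := (fubini_strip (P := μ) (fun R => integrable_strip_drift γ δ R)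
    (hf'.continuous_deriv le_rfl) hfc.deriv.deriv).2
  unfold driftPart
  rw [← h, ← integral_neg]
  congr 1; ext x
  simp only [mul_left_comm _ (γ + δ * x)]
  rw [integral_const_mul, integral_mul_stepKernel hf' hfc.deriv]
  ring

theorem driftPart_le (γ δ z : ℝ) : driftPart γ δ μ z ≤ |γ| + |δ| * |z| := by
  have h := norm_integral_le_of_norm_le_const (μ := μ)
    (f := fun x => (γ + δ * x) * stepKernel x z) (C := |γ| + |δ| * |z|)
    (Eventually.of_forall fun x => abs_drift_mul_stepKernel_le γ δ x z)
  rw [probReal_univ, mul_one] at h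
  exact (le_abs_self _).trans h

theorem continuousAt_driftPart (γ δ : ℝ) {z₀ : ℝ} (h : μ {z₀} = 0) :
    ContinuousAt (driftPart γ δ μ) z₀ := by
  refine continuousAt_integral_of_bound
    (fun z => Measurable.mul (by fun_prop) (measurable_stepKernel measurable_id measurable_const))
    (abs_nonneg δ)
    (fun z => Eventually.of_forall fun x => abs_drift_mul_stepKernel_le γ δ x z) ?_
  have h1 : ∀ᵐ x ∂μ, x ≠ z₀ := by simpa [ae_iff] using h
  filter_upwards [h1] with x hx
  exact continuousAt_const.mul (continuousAt_stepKernel hx)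

end Drift

theorem IsLevyMeasure.restrict {ν : Measure ℝ} (hν : IsLevyMeasure ν) (s : Set ℝ) :
    IsLevyMeasure (ν.restrict s) :=
  ⟨Measure.absolutelyContinuous_of_le Measure.restrict_le_self hν.1,
    (setLIntegral_le_lintegral _ _).trans_lt hν.2⟩

theorem Invariant.integral_deriv_deriv {ση2 γη σU2 γU : ℝ} {νη νU μ : Measure ℝ}
    (hνη : IsLevyMeasure νη) (hνU : IsLevyMeasure νU) [IsProbabilityMeasure μ]
    (hinv : Invariant ση2 γη σU2 γU νη νU μ) {f : ℝ → ℝ} (hf : ContDiff ℝ (⊤ : ℕ∞) f)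
    (hfc : HasCompactSupport f) :
    ∫ x, (ση2 + σU2 * x ^ 2) / 2 * deriv (deriv f) x ∂μ
      = ∫ z, deriv (deriv f) z * (driftPart γη γU μ z - jumpPart (fun _ => 1) μ νη z
        - jumpPart (fun x => x) μ (νU.restrict (Ici (-1))) z) := by
  have hf' : ContDiff ℝ 1 (deriv f) := (contDiff_infty_iff_deriv.1 hf).2.of_le (by simp)
  have hf'' := hf'.continuous_deriv le_rfl
  have hcf'' := hfc.deriv.deriv
  obtain ⟨iη, eη⟩ := jumpCoeff_one.integral_jump (μ := μ) hνη hf hfc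
  obtain ⟨iU, eU⟩ := jumpCoeff_id.integral_jump (μ := μ) (hνU.restrict (Ici (-1))) hf hfc
  have eD := integral_drift (μ := μ) γη γU hf hfc
  have iD : Integrable (fun x => (γη + γU * x) * deriv f x) μ :=
    (show Continuous fun x => (γη + γU * x) * deriv f x from
      (by fun_prop : Continuous fun x : ℝ => γη + γU * x).mul
        hf'.continuous).integrable_of_hasCompactSupport hfc.deriv.mul_left
  have iA : Integrable (fun x => (ση2 + σU2 * x ^ 2) / 2 * deriv (deriv f) x) μ :=
    (show Continuous fun x => (ση2 + σU2 * x ^ 2) / 2 * deriv (deriv f) x from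
      (by fun_prop : Continuous fun x : ℝ => (ση2 + σU2 * x ^ 2) / 2).mul
        hf'').integrable_of_hasCompactSupport hcf''.mul_left
  have h0 := hinv f hf hfc
  have jD : Integrable fun z => deriv (deriv f) z * driftPart γη γU μ z :=
    (locallyIntegrable_driftPart γη γU).integrable_smul_left_of_hasCompactSupport hf'' hcf''
  have jη : Integrable fun z => deriv (deriv f) z * jumpPart (fun _ => 1) μ νη z :=
    (jumpCoeff_one.locallyIntegrable_jumpPart hνη).integrable_smul_left_of_hasCompactSupport
      hf'' hcf''
  have jU : Integrable fun z => deriv (deriv f) z *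
      jumpPart (fun x => x) μ (νU.restrict (Ici (-1))) z :=
    (jumpCoeff_id.locallyIntegrable_jumpPart
      (hνU.restrict _)).integrable_smul_left_of_hasCompactSupport hf'' hcf''
  have jDη : Integrable fun z => deriv (deriv f) z * driftPart γη γU μ z
      - deriv (deriv f) z * jumpPart (fun _ => 1) μ νη z := jD.sub jη
  simp only [mul_sub]
  rw [integral_sub jDη jU, integral_sub jD jη, ← eη, ← eU, ← neg_eq_iff_eq_neg.2 eD]
  have hsum : (∫ x, levyGen ση2 γη σU2 γU νη νU f x ∂μ)
      = (∫ x, (ση2 + σU2 * x ^ 2) / 2 * deriv (deriv f) x ∂μ)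
        + (∫ x, (γη + γU * x) * deriv f x ∂μ)
        + (∫ x, (∫ y, (f (x + 1 * y) - f x -
            (if |y| ≤ 1 then 1 * y * deriv f x else 0)) ∂νη) ∂μ)
        + ∫ x, (∫ y in Ici (-1), (f (x + x * y) - f x -
            (if |y| ≤ 1 then x * y * deriv f x else 0)) ∂νU) ∂μ := by
    rw [← integral_add iA iD, ← integral_add (iA.fun_add iD) iη,
      ← integral_add ((iA.fun_add iD).fun_add iη) iU]
    congr 1; ext x
    simp only [levyGen, one_mul]
    ring
  rw [h0] at hsum
  linarith

theorem Invariant.exists_weighted_density {ση2 γη σU2 γU : ℝ} {νη νU μ : Measure ℝ}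
    (hση : 0 ≤ ση2) (hσU : 0 ≤ σU2)
    (hνη : IsLevyMeasure νη) (hνU : IsLevyMeasure νU) [IsProbabilityMeasure μ]
    (hinv : Invariant ση2 γη σU2 γU νη νU μ) :
    ∃ g : ℝ → ℝ, AEMeasurable g ∧
      μ.withDensity (fun x => ENNReal.ofReal ((ση2 + σU2 * x ^ 2) / 2))
        = volume.withDensity (fun z => ENNReal.ofReal (g z)) ∧
      (∃ B D : ℝ, ∀ z, g z ≤ B + D * |z|) ∧
      ∀ z₀, ∀ U ∈ nhds z₀, ∀ C : ENNReal, C ≠ ⊤ →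
        (∀ s ⊆ U, MeasurableSet s → μ s ≤ C * volume s) → ContinuousAt g z₀ := by
  have ha : Continuous fun x : ℝ => (ση2 + σU2 * x ^ 2) / 2 := by fun_prop
  have hloc : IsLocallyFiniteMeasure
      (μ.withDensity fun x => ENNReal.ofReal ((ση2 + σU2 * x ^ 2) / 2)) :=
    IsLocallyFiniteMeasure.withDensity_ofReal ha
  have hG : LocallyIntegrable fun z => driftPart γη γU μ z - jumpPart (fun _ => 1) μ νη z
      - jumpPart (fun x => x) μ (νU.restrict (Ici (-1))) z :=
    ((locallyIntegrable_driftPart γη γU).sub (jumpCoeff_one.locallyIntegrable_jumpPart hνη)).sub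
      (jumpCoeff_id.locallyIntegrable_jumpPart (hνU.restrict _))
  obtain ⟨α, β, hαβ⟩ := exists_affine_of_integral_deriv_deriv hG (m :=
    μ.withDensity fun x => ENNReal.ofReal ((ση2 + σU2 * x ^ 2) / 2)) fun f hf hfc => by
      rw [← hinv.integral_deriv_deriv hνη hνU hf hfc,
        integral_withDensity_eq_integral_toReal_smul (by fun_prop) (by simp)]
      congr 1; ext x
      rw [ENNReal.toReal_ofReal (by positivity), smul_eq_mul]
  have haff : Continuous fun z : ℝ => α + β * z := by fun_prop
  refine ⟨_, (hG.add haff.locallyIntegrable).aestronglyMeasurable.aemeasurable,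
    eq_withDensity_of_integral (hG.add haff.locallyIntegrable) hαβ, ?_, ?_⟩
  · refine ⟨|γη| + |α|, |γU| + (νη (Icc (-1) 1)ᶜ).toReal
      + (νU.restrict (Ici (-1)) (Icc (-1) 1)ᶜ).toReal + |β|, fun z => ?_⟩
    have h1 := driftPart_le (μ := μ) γη γU z
    have h2 := neg_jumpPart_le (c := fun _ => 1) (μ := μ) hνη z
    have h3 := neg_jumpPart_le (c := fun x => x) (μ := μ) (hνU.restrict (Ici (-1))) z
    have h4 := le_abs_self α
    have h5 : β * z ≤ |β| * |z| := by rw [← abs_mul]; exact le_abs_self _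
    simp only [Pi.add_apply]
    linarith
  · intro z₀ U hU C hCt hC
    exact (((continuousAt_driftPart γη γU (measure_singleton_eq_zero_of_le hU hC)).sub
      (jumpCoeff_one.continuousAt_jumpPart hνη hU hCt hC)).sub
      (jumpCoeff_id.continuousAt_jumpPart (hνU.restrict _) hU hCt hC)).add haff.continuousAt

theorem restrict_eq_withDensity_div {μ : Measure ℝ} {a g : ℝ → ℝ} (ha : Measurable a)
    (hg : AEMeasurable g) {V : Set ℝ} (hV : MeasurableSet V) (hpos : ∀ z ∈ V, 0 < a z)
    (hVc : volume Vᶜ = 0)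
    (h : μ.withDensity (fun z => ENNReal.ofReal (a z))
      = volume.withDensity (fun z => ENNReal.ofReal (g z))) :
    μ.restrict V = volume.withDensity (fun z => ENNReal.ofReal (g z / a z)) := by
  have hVae : ∀ᵐ z, z ∈ V := hVc
  have hVuniv : volume.restrict V = volume := Measure.restrict_eq_self_of_ae_mem hVae
  have hA : Measurable fun z => ENNReal.ofReal (a z) := ha.ennreal_ofReal
  rw [← withDensity_inv_same hA (μ := μ.restrict V) ?_ (by simp), ← restrict_withDensity hV, h,
    restrict_withDensity hV, hVuniv,
    ← withDensity_mul₀ hg.ennreal_ofReal hA.fun_inv.aemeasurable]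
  · refine withDensity_congr_ae ?_
    filter_upwards [hVae] with z hz
    rw [Pi.mul_apply, ENNReal.ofReal_div_of_pos (hpos z hz), div_eq_mul_inv]
  · filter_upwards [ae_restrict_mem hV] with z hz
    simpa using hpos z hz

/-- A measure with a density bounded above by a continuous function is locally dominated by
Lebesgue measure. -/
theorem exists_measure_le_of_restrict_eq_withDensity {μ : Measure ℝ} {V : Set ℝ} (hV : IsOpen V)
    {φ ψ : ℝ → ℝ} (h : μ.restrict V = volume.withDensity (fun z => ENNReal.ofReal (φ z)))
    {z₀ : ℝ} (hz₀ : z₀ ∈ V) (hψ : ContinuousAt ψ z₀) (hle : ∀ z ∈ V, φ z ≤ ψ z) :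
    ∃ U ∈ nhds z₀, ∃ C : ENNReal, C ≠ ⊤ ∧
      ∀ s ⊆ U, MeasurableSet s → μ s ≤ C * volume s := by
  refine ⟨V ∩ {z | ψ z < ψ z₀ + 1}, inter_mem (hV.mem_nhds hz₀)
    (hψ.eventually (gt_mem_nhds (lt_add_one _))), ENNReal.ofReal (ψ z₀ + 1),
    ENNReal.ofReal_ne_top, fun s hs hsm => ?_⟩
  rw [← Measure.restrict_eq_self μ (hs.trans inter_subset_left), h, withDensity_apply _ hsm,
    ← setLIntegral_const]
  exact setLIntegral_mono' hsm fun z hz => ENNReal.ofReal_le_ofReal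
    ((hle z (hs hz).1).trans (hs hz).2.le)

end KEF

theorem stmt7 (ση2 γη σU2 γU : ℝ) (νη νU : Measure ℝ)
    (hση : 0 ≤ ση2) (hσU : 0 ≤ σU2)
    (hνη : IsLevyMeasure νη) (hνU : IsLevyMeasure νU)
    (hconc : νU (Iio (-1 : ℝ)) = 0)
    (hnz : ¬(ση2 = 0 ∧ νη = 0 ∧ γη = 0))
    (μ : Measure ℝ) [IsProbabilityMeasure μ]
    (hinv : Invariant ση2 γη σU2 γU νη νU μ)
    (hσ : 0 < ση2 + σU2) :
    ∃ fμ : ℝ → ℝ,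
      (0 < ση2 →
        μ = volume.withDensity (fun z => ENNReal.ofReal (fμ z)) ∧ Continuous fμ) ∧
      (0 < σU2 →
        μ.restrict (({0} : Set ℝ)ᶜ) = volume.withDensity (fun z => ENNReal.ofReal (fμ z)) ∧
        ContinuousOn fμ (({0} : Set ℝ)ᶜ)) ∧
      ∃ M₁ M₂ : ℝ, 0 < M₁ ∧ 0 < M₂ ∧
        ∀ z : ℝ, z ≠ 0 → (ση2 + z ^ 2 * σU2) * fμ z ≤ M₁ + M₂ * |z| := by
  obtain ⟨g, hgm, hg, ⟨B, D, hBD⟩, hgc⟩ := hinv.exists_weighted_density hση hσU hνη hνU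
  set a : ℝ → ℝ := fun x => (ση2 + σU2 * x ^ 2) / 2 with ha
  have hac : Continuous a := by fun_prop
  have hpos : ∀ z ≠ 0, 0 < a z := by
    intro z hz
    have hz2 : 0 < z ^ 2 := by positivity
    rcases hση.eq_or_lt with h | h
    · have : 0 < σU2 * z ^ 2 := mul_pos (by linarith) hz2
      simp only [ha]; linarith
    · have : 0 ≤ σU2 * z ^ 2 := by positivity
      simp only [ha]; linarith
  have hcont : ∀ V : Set ℝ, IsOpen V → (∀ z ∈ V, 0 < a z) →
      μ.restrict V = volume.withDensity (fun z => ENNReal.ofReal (g z / a z)) →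
      ∀ z₀ ∈ V, ContinuousAt (fun z => g z / a z) z₀ := by
    intro V hV hVa hμ z₀ hz₀
    obtain ⟨U, hU, C, hCt, hC⟩ := exists_measure_le_of_restrict_eq_withDensity hV
      (ψ := fun z => (B + D * |z|) / a z) hμ hz₀
      ((by fun_prop : Continuous fun z : ℝ => B + D * |z|).continuousAt.div hac.continuousAt
        (hVa z₀ hz₀).ne') fun z hz => div_le_div_of_nonneg_right (hBD z) (hVa z hz).le
    exact (hgc z₀ U hU C hCt hC).div hac.continuousAt (hVa z₀ hz₀).ne'
  refine ⟨fun z => g z / a z, fun h => ?_, fun h => ?_, 2 * |B| + 1, 2 * |D| + 1, by positivity,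
    by positivity, fun z hz => ?_⟩
  · have hall : ∀ z ∈ univ, 0 < a z := by
      intro z _
      have : 0 ≤ σU2 * z ^ 2 := by positivity
      simp only [ha]; linarith
    have hμ := restrict_eq_withDensity_div hac.measurable hgm MeasurableSet.univ hall (by simp) hg
    exact ⟨by rw [← hμ, Measure.restrict_univ], continuous_iff_continuousAt.2 fun z =>
      hcont univ isOpen_univ hall hμ z (mem_univ z)⟩
  · have hμ := restrict_eq_withDensity_div hac.measurable hgm
      (measurableSet_singleton (0 : ℝ)).compl hpos (by simp) hg
    exact ⟨hμ, fun z hz => (hcont _ isOpen_compl_singleton hpos hμ z hz).continuousWithinAt⟩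
  · have h1 : (ση2 + z ^ 2 * σU2) * (g z / a z) = 2 * g z := by
      rw [show ση2 + z ^ 2 * σU2 = 2 * a z by simp only [ha]; ring]
      field_simp [(hpos z hz).ne']
    rw [h1]
    have h2 := hBD z
    have h3 := le_abs_self B
    have h4 := mul_le_mul_of_nonneg_right (le_abs_self D) (abs_nonneg z)
    linarith [abs_nonneg z]

end
end
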